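/- arXiv:math/0005202 — 2 statements merged into one kernel-verified Lean document; each statement's English description precedes it below -/
import Mathlib

section
/- (Terracini's Lemma) Let X ⊂ P^r be a projective variety and let P_0, ..., P_k be general points of X and u a general point of the linear span ⟨P_0, ..., P_k⟩. Then the embedded tangent space to S_k(X) at u equals the linear span of the embedded tangent spaces T_{P_0}X, ..., T_{P_k}X. -/
open Submodule

noncomputable section

/-- Polynomial functions on a complex module: the subalgebra of functions generated by
the linear functionals. -/
def PolyFun (W : Type*) [AddCommGroup W] [Module ℂ W] : Subalgebra ℂ (W → ℂ) :=
  Algebra.adjoin ℂ {f : W → ℂ | IsLinearMap ℂ f}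

/-- A subset of a complex module is algebraic (Zariski closed) if it is the common zero
set of a family of polynomial functions. -/
def IsAlgSet {W : Type*} [AddCommGroup W] [Module ℂ W] (X : Set W) : Prop :=
  ∃ S : Set (W → ℂ), S ⊆ (PolyFun W : Set (W → ℂ)) ∧ X = {x | ∀ f ∈ S, f x = 0}

/-- Zariski closure. -/
def zcl {W : Type*} [AddCommGroup W] [Module ℂ W] (A : Set W) : Set W :=
  ⋂₀ {Y | IsAlgSet Y ∧ A ⊆ Y}

/-- Irreducible algebraic set. -/
def IsIrrAlg {W : Type*} [AddCommGroup W] [Module ℂ W] (X : Set W) : Prop :=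
  X.Nonempty ∧ IsAlgSet X ∧
    ∀ Y Z : Set W, IsAlgSet Y → IsAlgSet Z → X ⊆ Y ∪ Z → X ⊆ Y ∨ X ⊆ Z

/-- Dimension of an (affine) algebraic set: the supremum of the lengths of strict chains
of irreducible algebraic subsets contained in it. -/
def adim {W : Type*} [AddCommGroup W] [Module ℂ W] (X : Set W) : ℕ∞ :=
  sSup {d : ℕ∞ | ∃ n : ℕ, d = (n : ℕ∞) ∧
    ∃ c : Fin (n + 1) → Set W, StrictMono c ∧ ∀ i, IsIrrAlg (c i) ∧ c i ⊆ X}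

/-- Projective dimension of a cone: one less than the dimension of the affine cone. -/
def pdim {W : Type*} [AddCommGroup W] [Module ℂ W] (X : Set W) : ℕ∞ := adim X - 1

/-- A cone in a complex module (the affine cone of a projective set). -/
def IsCone {W : Type*} [AddCommGroup W] [Module ℂ W] (X : Set W) : Prop :=
  (0 : W) ∈ X ∧ ∀ (c : ℂ) (x : W), x ∈ X → c • x ∈ X

/-- The affine cone of an integral projective variety: an irreducible algebraic cone,
different from the origin alone. -/
def IsProjVar {W : Type*} [AddCommGroup W] [Module ℂ W] (X : Set W) : Prop :=
  IsAlgSet X ∧ IsCone X ∧ IsIrrAlg X ∧ X ≠ {0}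

/-- Non-degenerate: the cone spans the ambient space. -/
def Nondeg {W : Type*} [AddCommGroup W] [Module ℂ W] (X : Set W) : Prop :=
  Submodule.span ℂ X = ⊤

/-- The projective set is a cone over some vertex: there is a point `v` (vertex) of the
variety such that the variety is a union of lines through the vertex. -/
def IsConeVar {W : Type*} [AddCommGroup W] [Module ℂ W] (X : Set W) : Prop :=
  ∃ v ∈ X, v ≠ 0 ∧ ∀ x ∈ X, ∀ a b : ℂ, a • v + b • x ∈ X

/-- Affine cone of the `k`-th secant variety `S_k(X)`: the Zariski closure of the union
of the linear spans of `k+1` points of `X`. -/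
def Sec {W : Type*} [AddCommGroup W] [Module ℂ W] (X : Set W) (k : ℕ) : Set W :=
  zcl (⋃ p ∈ {p : Fin (k + 1) → W | ∀ i, p i ∈ X},
    (Submodule.span ℂ (Set.range p) : Set W))


/-- Embedded (Zariski) tangent space at a point of a cone: vectors annihilated by the
differentials at `x` of all polynomial functions vanishing on `X`. -/
def TangSp {n : ℕ} (X : Set (Fin n → ℂ)) (x : Fin n → ℂ) : Set (Fin n → ℂ) :=
  {w | ∀ f : (Fin n → ℂ) → ℂ, f ∈ PolyFun (Fin n → ℂ) → (∀ y ∈ X, f y = 0) →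
    fderiv ℂ f x w = 0}

theorem exists_derivation_of_formallySmooth {R B F : Type} [Field R] [CommRing B] [Field F]
    [Algebra R B] [Algebra R F] [Algebra B F] [IsScalarTower R B F]
    [Algebra.FormallySmooth B F] (d : Derivation R B F) :
    ∃ D : Derivation R F F, ∀ b, D (algebraMap B F b) = d b := by
  have hinj : Function.Injective (KaehlerDifferential.mapBaseChange R B F) := by
    have h := Algebra.H1Cotangent.exact_δ_mapBaseChange R B F
    rw [injective_iff_map_eq_zero]
    intro x hx
    obtain ⟨y, rfl⟩ := (h x).1 hx
    have : Subsingleton (Algebra.H1Cotangent B F) := Algebra.FormallySmooth.subsingleton_h1Cotangent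
    rw [Subsingleton.elim y 0, map_zero]
  obtain ⟨g, hg⟩ := LinearMap.exists_leftInverse_of_injective
    (KaehlerDifferential.mapBaseChange R B F) (LinearMap.ker_eq_bot.2 hinj)
  let e : TensorProduct B F (Ω[B⁄R]) →ₗ[F] F :=
    TensorProduct.AlgebraTensorModule.lift
      ((LinearMap.lsmul F (Ω[B⁄R] →ₗ[B] F)).flip d.liftKaehlerDifferential)
  refine ⟨(e ∘ₗ g).compDer (KaehlerDifferential.D R F), fun b => ?_⟩
  have h1 : KaehlerDifferential.D R F (algebraMap B F b) =
      KaehlerDifferential.mapBaseChange R B F (1 ⊗ₜ KaehlerDifferential.D R B b) := by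
    simp
  have h2 := LinearMap.congr_fun hg (1 ⊗ₜ KaehlerDifferential.D R B b)
  simp only [LinearMap.comp_apply, LinearMap.id_apply] at h2
  change e (g (KaehlerDifferential.D R F (algebraMap B F b))) = _
  rw [h1, h2]
  simp [e]

theorem Algebra.FormallySmooth.of_charZero {K L : Type} [Field K] [Field L] [CharZero K]
    [Algebra K L] : Algebra.FormallySmooth K L := by
  obtain ⟨s, hs⟩ := exists_isTranscendenceBasis K L
  have : Algebra.IsAlgebraic (IntermediateField.adjoin K (Set.range ((↑) : s → L))) L :=
    hs.isAlgebraic_field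
  exact .of_algebraicIndependent_of_isSeparable hs.1

theorem exists_derivation_of_annihilates {ι F : Type} [Fintype ι] [Field F] [Algebra ℂ F]
    (u w : ι → F)
    (hw : ∀ f : MvPolynomial ι ℂ, MvPolynomial.aeval u f = 0 →
      ∑ s, MvPolynomial.aeval u (MvPolynomial.pderiv s f) * w s = 0) :
    ∃ D : Derivation ℂ F F, ∀ s, D (u s) = w s := by
  let φ : MvPolynomial ι ℂ →ₐ[ℂ] F := MvPolynomial.aeval u
  let d₀ : MvPolynomial ι ℂ →ₗ[ℂ] F :=
    ∑ s, (LinearMap.mulRight ℂ (w s)) ∘ₗ φ.toLinearMap ∘ₗ (MvPolynomial.pderiv s).toLinearMap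
  have hd₀ : ∀ f, d₀ f = ∑ s, φ (MvPolynomial.pderiv s f) * w s := fun f => by
    simp [d₀, LinearMap.sum_apply]
  have hker : LinearMap.ker φ.rangeRestrict.toLinearMap ≤ LinearMap.ker d₀ := fun f hf => by
    rw [LinearMap.mem_ker, hd₀]
    exact hw f (by simpa [Subtype.ext_iff] using hf)
  have hsurj : Function.Surjective φ.rangeRestrict := φ.rangeRestrict_surjective
  obtain ⟨g, hg⟩ := LinearMap.exists_rightInverse_of_surjective φ.rangeRestrict.toLinearMap
    (LinearMap.range_eq_top.2 hsurj)
  have hval : ∀ f, d₀ (g (φ.rangeRestrict f)) = d₀ f := fun f => by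
    rw [← sub_eq_zero, ← map_sub]
    apply hker
    have := LinearMap.congr_fun hg (φ.rangeRestrict f)
    simp only [LinearMap.comp_apply, LinearMap.id_apply, AlgHom.toLinearMap_apply] at this
    simp [this]
  let d : Derivation ℂ φ.range F := Derivation.mk' (d₀ ∘ₗ g) (by
    intro a b
    obtain ⟨a, rfl⟩ := hsurj a
    obtain ⟨b, rfl⟩ := hsurj b
    simp only [LinearMap.comp_apply]
    rw [← map_mul, hval, hval, hval, hd₀, hd₀, hd₀]
    simp only [Subalgebra.smul_def, smul_eq_mul, Finset.mul_sum, ← Finset.sum_add_distrib,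
      AlgHom.coe_codRestrict, AlgHom.rangeRestrict]
    refine Finset.sum_congr rfl fun s _ => ?_
    simp [Derivation.leibniz]
    ring)
  let K := FractionRing φ.range
  let _ : Algebra K F := FractionRing.liftAlgebra φ.range F
  have : IsScalarTower φ.range K F := FractionRing.isScalarTower_liftAlgebra _ _
  have : CharZero K := charZero_of_injective_algebraMap (algebraMap ℂ K).injective
  have : Algebra.FormallySmooth K F := .of_charZero
  have : Algebra.FormallySmooth φ.range K := .of_isLocalization (nonZeroDivisors φ.range)
  have : Algebra.FormallySmooth φ.range F := .comp _ K _
  obtain ⟨D, hD⟩ := exists_derivation_of_formallySmooth d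
  refine ⟨D, fun s => ?_⟩
  have h1 := hD (φ.rangeRestrict (MvPolynomial.X s))
  have h2 : d (φ.rangeRestrict (MvPolynomial.X s)) = w s := by
    change d₀ (g (φ.rangeRestrict (MvPolynomial.X s))) = _
    classical
    rw [hval, hd₀]
    simp [MvPolynomial.pderiv_X, Pi.single_apply]
  rw [h2] at h1
  rw [← h1]
  congr 1
  simp [φ]

theorem eval_linear_mem_polyFun {σ W : Type*} [AddCommGroup W] [Module ℂ W]
    (ℓ : σ → W →ₗ[ℂ] ℂ) (p : MvPolynomial σ ℂ) :
    (fun x => MvPolynomial.eval (fun s => ℓ s x) p) ∈ PolyFun W := by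
  induction p using MvPolynomial.induction_on with
  | C a =>
    simp only [MvPolynomial.eval_C]
    exact (PolyFun W).algebraMap_mem a
  | add p q hp hq =>
    simp only [map_add]
    exact (PolyFun W).add_mem hp hq
  | mul_X p s hp =>
    simp only [map_mul, MvPolynomial.eval_X]
    exact (PolyFun W).mul_mem hp (Algebra.subset_adjoin (ℓ s).isLinear)

theorem eval_mem_polyFun {n : ℕ} (p : MvPolynomial (Fin n) ℂ) :
    (fun x : Fin n → ℂ => MvPolynomial.eval x p) ∈ PolyFun (Fin n → ℂ) :=
  eval_linear_mem_polyFun (fun s => LinearMap.proj s) p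

theorem exists_eval_of_mem_polyFun {n : ℕ} {f : (Fin n → ℂ) → ℂ}
    (hf : f ∈ PolyFun (Fin n → ℂ)) :
    ∃ p : MvPolynomial (Fin n) ℂ, f = fun x => MvPolynomial.eval x p := by
  induction hf using Algebra.adjoin_induction with
  | mem f hf =>
    refine ⟨∑ s, MvPolynomial.C (f (Pi.single s 1)) * MvPolynomial.X s, funext fun x => ?_⟩
    have h := LinearMap.pi_apply_eq_sum_univ (hf.mk' f) x
    simp only [IsLinearMap.mk'_apply, smul_eq_mul] at h
    rw [h]
    simp only [map_sum, map_mul, MvPolynomial.eval_C, MvPolynomial.eval_X]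
    refine Finset.sum_congr rfl fun s _ => ?_
    rw [mul_comm]
    congr 2
    ext t
    simp [Pi.single_apply, eq_comm]
  | algebraMap a => exact ⟨MvPolynomial.C a, by ext; simp⟩
  | add f g _ _ hf hg =>
    obtain ⟨p, rfl⟩ := hf
    obtain ⟨q, rfl⟩ := hg
    exact ⟨p + q, by ext; simp⟩
  | mul f g _ _ hf hg =>
    obtain ⟨p, rfl⟩ := hf
    obtain ⟨q, rfl⟩ := hg
    exact ⟨p * q, by ext; simp⟩

theorem MvPolynomial.hasFDerivAt_eval {n : ℕ} (p : MvPolynomial (Fin n) ℂ) (x : Fin n → ℂ) :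
    HasFDerivAt (fun y => MvPolynomial.eval y p)
      (∑ s, MvPolynomial.eval x (MvPolynomial.pderiv s p) •
        ContinuousLinearMap.proj (R := ℂ) (φ := fun _ : Fin n => ℂ) s) x := by
  classical
  induction p using MvPolynomial.induction_on with
  | C a =>
    simp only [MvPolynomial.eval_C]
    exact (hasFDerivAt_const (𝕜 := ℂ) a x).congr_fderiv (by ext; simp)
  | add p q hp hq =>
    have h : (fun y => MvPolynomial.eval y (p + q)) =
        (fun y => MvPolynomial.eval y p) + fun y => MvPolynomial.eval y q := by
      ext
      simp
    rw [h]
    refine (hp.add hq).congr_fderiv ?_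
    ext w
    simp [add_mul, Finset.sum_add_distrib]
  | mul_X p s hp =>
    simp only [map_mul, MvPolynomial.eval_X]
    refine (hp.mul (hasFDerivAt_apply s x)).congr_fderiv ?_
    ext w
    simp [Derivation.leibniz, MvPolynomial.pderiv_X, Pi.single_apply, add_mul, Finset.sum_add_distrib,
      Finset.mul_sum, apply_ite, mul_assoc]

theorem MvPolynomial.fderiv_eval_apply {n : ℕ} (p : MvPolynomial (Fin n) ℂ) (x w : Fin n → ℂ) :
    fderiv ℂ (fun y => MvPolynomial.eval y p) x w =
      ∑ s, MvPolynomial.eval x (MvPolynomial.pderiv s p) * w s := by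
  rw [(MvPolynomial.hasFDerivAt_eval p x).fderiv]
  simp

theorem mem_tangSp_iff {n : ℕ} {X : Set (Fin n → ℂ)} {x w : Fin n → ℂ} :
    w ∈ TangSp X x ↔ ∀ p : MvPolynomial (Fin n) ℂ, (∀ y ∈ X, MvPolynomial.eval y p = 0) →
      ∑ s, MvPolynomial.eval x (MvPolynomial.pderiv s p) * w s = 0 := by
  constructor
  · intro h p hp
    rw [← MvPolynomial.fderiv_eval_apply]
    exact h _ (eval_mem_polyFun p) hp
  · intro h f hf hX
    obtain ⟨p, rfl⟩ := exists_eval_of_mem_polyFun hf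
    rw [MvPolynomial.fderiv_eval_apply]
    exact h p hX

/-- `TangSp` as a submodule. -/
def tangSubmodule {n : ℕ} (X : Set (Fin n → ℂ)) (x : Fin n → ℂ) : Submodule ℂ (Fin n → ℂ) where
  carrier := TangSp X x
  zero_mem' := fun f _ _ => map_zero _
  add_mem' := fun ha hb f hf hX => by rw [map_add, ha f hf hX, hb f hf hX, add_zero]
  smul_mem' := fun c a ha f hf hX => by rw [map_smul, ha f hf hX, smul_zero]

theorem eval_eq_zero_on_sec_iff {n k : ℕ} {X : Set (Fin n → ℂ)} {p : MvPolynomial (Fin n) ℂ} :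
    (∀ y ∈ Sec X k, MvPolynomial.eval y p = 0) ↔
      ∀ P : Fin (k + 1) → Fin n → ℂ, (∀ i, P i ∈ X) →
        ∀ u ∈ Submodule.span ℂ (Set.range P), MvPolynomial.eval u p = 0 := by
  constructor
  · intro h P hP u hu
    refine h u (Set.mem_sInter.2 fun Y hY => hY.2 ?_)
    exact Set.mem_biUnion (show P ∈ {p : Fin (k + 1) → Fin n → ℂ | ∀ i, p i ∈ X} from hP) hu
  · intro h y hy
    refine Set.mem_sInter.1 hy {x | MvPolynomial.eval x p = 0}
      ⟨⟨{fun x => MvPolynomial.eval x p}, ?_, ?_⟩, ?_⟩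
    · simpa using eval_mem_polyFun p
    · simp
    · intro u hu
      obtain ⟨P, hP, hu⟩ := Set.mem_iUnion₂.1 hu
      exact h P hP u hu

theorem tangSp_subset_tangSp_sec_of_ne_zero {n k : ℕ} {X : Set (Fin n → ℂ)}
    {P : Fin (k + 1) → Fin n → ℂ} (hP : ∀ i, P i ∈ X) (c : Fin (k + 1) → ℂ)
    {i : Fin (k + 1)} (hc : c i ≠ 0) :
    TangSp X (P i) ⊆ TangSp (Sec X k) (∑ j, c j • P j) := by
  intro w hw
  rw [mem_tangSp_iff]
  intro p hp
  rw [eval_eq_zero_on_sec_iff] at hp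
  set u := ∑ j, c j • P j with hu
  let A : (Fin n → ℂ) → Fin n → ℂ := fun y => u + c i • (y - P i)
  let q : MvPolynomial (Fin n) ℂ := MvPolynomial.bind₁
    (fun s => MvPolynomial.C (u s - c i * P i s) + MvPolynomial.C (c i) * MvPolynomial.X s) p
  have hq : ∀ y, MvPolynomial.eval y q = MvPolynomial.eval (A y) p := fun y => by
    change MvPolynomial.eval₂Hom _ _ _ = _
    rw [MvPolynomial.eval₂Hom_bind₁]
    simp only [map_add, map_mul, MvPolynomial.eval₂Hom_C, MvPolynomial.eval₂Hom_X']
    change MvPolynomial.eval _ p = _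
    congr 2
    funext s
    simp [A]
    ring
  have hA : HasFDerivAt A (c i • ContinuousLinearMap.id ℂ (Fin n → ℂ)) (P i) :=
    (((hasFDerivAt_id (P i)).sub_const (P i)).const_smul (c i)).const_add u
  have hX : ∀ y ∈ X, MvPolynomial.eval y q = 0 := fun y hy => by
    rw [hq]
    classical
    refine hp (Function.update P i y) (fun j => ?_) _ ?_
    · by_cases hj : j = i
      · subst hj; simpa using hy
      · simpa [hj] using hP j
    · have hAy : A y = ∑ j, c j • Function.update P i y j := by
        simp only [A, hu]
        rw [← Finset.add_sum_erase _ _ (Finset.mem_univ i),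
          ← Finset.add_sum_erase _ (fun j => c j • Function.update P i y j) (Finset.mem_univ i)]
        rw [Finset.sum_congr rfl (g := fun j => c j • Function.update P i y j)
          (s₂ := Finset.univ.erase i) fun j hj => by simp [Finset.ne_of_mem_erase hj]]
        simp [smul_sub]
        abel
      rw [hAy]
      exact Submodule.sum_mem _ fun j _ => Submodule.smul_mem _ _
        (Submodule.subset_span ⟨j, rfl⟩)
  have h0 := hw _ (eval_mem_polyFun q) hX
  have hAP : A (P i) = u := by simp [A]
  have h1 := (MvPolynomial.hasFDerivAt_eval p (A (P i))).comp (P i) hA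
  have h2 : (fun y => MvPolynomial.eval y q) = (fun y => MvPolynomial.eval y p) ∘ A :=
    funext hq
  rw [h2, h1.fderiv, hAP] at h0
  simp only [ContinuousLinearMap.comp_apply, smul_apply, map_smul,
    ContinuousLinearMap.id_apply, smul_eq_mul, mul_eq_zero, hc, false_or] at h0
  simpa using h0

theorem tangSp_subset_tangSp_sec {n k : ℕ} {X : Set (Fin n → ℂ)}
    {P : Fin (k + 1) → Fin n → ℂ} (hP : ∀ i, P i ∈ X) {u : Fin n → ℂ}
    (hu : u ∈ Submodule.span ℂ (Set.range P)) (i : Fin (k + 1)) :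
    TangSp X (P i) ⊆ TangSp (Sec X k) u := by
  obtain ⟨c, rfl⟩ := (Submodule.mem_span_range_iff_exists_fun ℂ).1 hu
  by_cases hc : c i = 0
  · intro w hw
    rw [mem_tangSp_iff]
    intro p hp
    let g : ℂ → ℂ := fun t =>
      ∑ s, MvPolynomial.eval ((∑ j, c j • P j) + t • P i) (MvPolynomial.pderiv s p) * w s
    have hg : Continuous g := by
      refine continuous_finsetSum _ fun s _ => Continuous.mul ?_ continuous_const
      exact (MvPolynomial.continuous_eval _).comp (by fun_prop)
    have hg0 : ∀ t ∈ ({0}ᶜ : Set ℂ), g t = 0 := fun t ht => by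
      have h := tangSp_subset_tangSp_sec_of_ne_zero hP (c + Pi.single i t) (i := i)
        (by simpa [hc] using ht) hw
      have hsum : ∑ j, (c + Pi.single i t : Fin (k + 1) → ℂ) j • P j = (∑ j, c j • P j) + t • P i := by
        simp [add_smul, Finset.sum_add_distrib, Pi.single_apply, ite_smul]
      rw [hsum, mem_tangSp_iff] at h
      exact h p hp
    have h := (dense_compl_singleton (0 : ℂ)).closure_eq
    have h0 : g 0 = 0 :=
      (isClosed_singleton.preimage hg).closure_subset_iff.2 hg0 (h ▸ Set.mem_univ (0 : ℂ))
    simpa [g] using h0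
  · exact tangSp_subset_tangSp_sec_of_ne_zero hP c hc

theorem Ideal.exists_notMem_forall_mul_mem_of_mem_minimalPrimes {R : Type*} [CommRing R]
    [IsNoetherianRing R] {J p : Ideal R} (hJ : J.IsRadical) (hp : p ∈ J.minimalPrimes) :
    ∃ h ∉ p, ∀ f ∈ p, h * f ∈ J := by
  classical
  have hfin := J.finite_minimalPrimes_of_isNoetherianRing R
  have hprime : p.IsPrime := hp.1.1
  have hle : ¬ ((hfin.toFinset.erase p).inf id ≤ p) := fun hle => by
    obtain ⟨p', hp', hle'⟩ := (Ideal.IsPrime.inf_le' hprime).1 hle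
    rw [Finset.mem_erase, Set.Finite.mem_toFinset] at hp'
    exact hp'.1 (le_antisymm hle' (hp.2 hp'.2.1 hle'))
  obtain ⟨h, hh, hhp⟩ := SetLike.not_le_iff_exists.1 hle
  refine ⟨h, hhp, fun f hf => ?_⟩
  rw [← hJ.radical, ← Ideal.sInf_minimalPrimes, Submodule.mem_sInf]
  intro p' hp'
  by_cases hpp : p' = p
  · exact hpp ▸ p.mul_mem_left h hf
  · exact Ideal.mul_mem_right f p' (Finset.inf_le (f := id)
      (Finset.mem_erase.2 ⟨hpp, hfin.mem_toFinset.2 hp'⟩) hh)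

/-- The common kernel of a family of linear forms is the image of an endomorphism that differs
from the identity by a combination of finitely many of these forms. -/
theorem exists_matrix_of_linear_forms {ι κ F : Type*} [Fintype ι] [DecidableEq ι] [Field F]
    (a : κ → ι → F) :
    ∃ (M : ι → ι → F) (B : Finset κ) (c : ι → κ → F),
      (∀ f s, ∑ t, a f t * M t s = 0) ∧
      ∀ t s, (if t = s then 1 else 0) = M t s + ∑ f ∈ B, c t f * a f s := by
  classical
  let φ : κ → Module.Dual F (ι → F) := fun f => ∑ t, a f t • LinearMap.proj t
  have hφ : ∀ f x, φ f x = ∑ t, a f t * x t := fun f x => by simp [φ, LinearMap.sum_apply]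
  let Φ := Submodule.span F (Set.range φ)
  let T := Φ.dualCoannihilator
  obtain ⟨g, hg⟩ := LinearMap.exists_leftInverse_of_injective T.subtype T.ker_subtype
  have hmem : ∀ t, (LinearMap.proj t : Module.Dual F (ι → F)) -
      LinearMap.proj t ∘ₗ T.subtype ∘ₗ g ∈ Φ := fun t => by
    rw [← Subspace.dualCoannihilator_dualAnnihilator_eq (W := Φ), Submodule.mem_dualAnnihilator]
    intro x hx
    have h := LinearMap.congr_fun hg ⟨x, hx⟩
    simp only [LinearMap.comp_apply, LinearMap.id_apply, Submodule.subtype_apply] at h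
    simp [h]
  choose c hc using fun t => (Finsupp.mem_span_range_iff_exists_finsupp).1 (hmem t)
  refine ⟨fun t s => (g (Pi.single s 1) : ι → F) t, Finset.univ.biUnion fun t => (c t).support,
    fun t f => c t f, fun f s => ?_, fun t s => ?_⟩
  · rw [← hφ]
    exact (Submodule.mem_dualCoannihilator _).1 (g (Pi.single s 1)).2 _
      (Submodule.subset_span ⟨f, rfl⟩)
  · have h := LinearMap.congr_fun (hc t) (Pi.single s 1)
    rw [Finsupp.sum_of_support_subset _ (s := Finset.univ.biUnion fun t => (c t).support)
      (fun f hf => Finset.mem_biUnion.2 ⟨t, Finset.mem_univ t, hf⟩) _ (by simp)] at h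
    simp only [LinearMap.sum_apply, LinearMap.smul_apply, hφ, LinearMap.sub_apply,
      LinearMap.comp_apply, LinearMap.proj_apply, Submodule.subtype_apply, smul_eq_mul,
      Pi.single_apply, mul_ite, mul_one, mul_zero, Finset.sum_ite_eq', Finset.mem_univ,
      if_true] at h
    rw [h]
    ring

theorem Derivation.map_mvPolynomial_aeval {k ι A : Type*} [Fintype ι] [CommRing k] [CommRing A]
    [Algebra k A] (D : Derivation k A A) (u : ι → A) (f : MvPolynomial ι k) :
    D (MvPolynomial.aeval u f) = ∑ s, MvPolynomial.aeval u (MvPolynomial.pderiv s f) * D (u s) := by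
  classical
  induction f using MvPolynomial.induction_on with
  | C a => simp
  | add p q hp hq => simp [hp, hq, add_mul, Finset.sum_add_distrib]
  | mul_X p s hp =>
    simp [hp, Derivation.leibniz, MvPolynomial.pderiv_X, Pi.single_apply, add_mul,
      Finset.sum_add_distrib, Finset.mul_sum, apply_ite, mul_assoc]

/-- Clearing denominators for finitely many elements of the fraction field of `R ⧸ p`. -/
theorem exists_common_denominator {R ι : Type*} [CommRing R] (p : Ideal R) [p.IsPrime] [Finite ι]
    (x : ι → FractionRing (R ⧸ p)) :
    ∃ b ∉ p, ∃ a : ι → R,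
      ∀ i, algebraMap R (FractionRing (R ⧸ p)) (a i) = algebraMap R (FractionRing (R ⧸ p)) b * x i := by
  obtain ⟨b, hb⟩ := IsLocalization.exist_integer_multiples_of_finite
    (nonZeroDivisors (R ⧸ p)) x
  choose a ha using hb
  obtain ⟨b', hb'⟩ := Ideal.Quotient.mk_surjective (b : R ⧸ p)
  choose a' ha' using fun i => Ideal.Quotient.mk_surjective (a i)
  refine ⟨b', fun hmem => nonZeroDivisors.ne_zero b.2 ?_, a', fun i => ?_⟩
  · rw [← hb', Ideal.Quotient.eq_zero_iff_mem.2 hmem]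
  · rw [IsScalarTower.algebraMap_apply R (R ⧸ p), IsScalarTower.algebraMap_apply R (R ⧸ p) _ b']
    simp only [Ideal.Quotient.algebraMap_eq, hb', ha', ha, Algebra.smul_def]

theorem algebraMap_fractionRing_quotient_eq_zero_iff {R : Type*} [CommRing R] (p : Ideal R)
    [p.IsPrime] {f : R} : algebraMap R (FractionRing (R ⧸ p)) f = 0 ↔ f ∈ p := by
  rw [IsScalarTower.algebraMap_apply R (R ⧸ p), FaithfulSMul.algebraMap_eq_zero_iff,
    Ideal.Quotient.algebraMap_eq, Ideal.Quotient.eq_zero_iff_mem]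

/-- If a polynomial vector lies in the span of other polynomial vectors at every point of `V`,
then so it does over the function field of a component of `V`. -/
theorem mem_span_functionField {σ : Type} {κ n : ℕ} {V : Set (σ → ℂ)}
    {p : Ideal (MvPolynomial σ ℂ)} [p.IsPrime] {h : MvPolynomial σ ℂ} (hh : h ∉ p)
    (hmul : ∀ f ∈ p, ∀ z ∈ V, MvPolynomial.eval z h * MvPolynomial.eval z f = 0)
    (hp : ∀ f, (∀ z ∈ V, MvPolynomial.eval z f = 0) → f ∈ p)
    (P : Fin κ → Fin n → MvPolynomial σ ℂ) (u : Fin n → MvPolynomial σ ℂ)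
    (hu : ∀ z ∈ V, (fun s => MvPolynomial.eval z (u s)) ∈
      Submodule.span ℂ (Set.range fun i s => MvPolynomial.eval z (P i s))) :
    (fun s => algebraMap _ (FractionRing (MvPolynomial σ ℂ ⧸ p)) (u s)) ∈
      Submodule.span (FractionRing (MvPolynomial σ ℂ ⧸ p))
        (Set.range fun i s => algebraMap _ (FractionRing (MvPolynomial σ ℂ ⧸ p)) (P i s)) := by
  classical
  let F := FractionRing (MvPolynomial σ ℂ ⧸ p)
  let ψ : MvPolynomial σ ℂ →+* F := algebraMap _ F
  have hψ : ∀ f, ψ f = 0 ↔ f ∈ p := fun f => algebraMap_fractionRing_quotient_eq_zero_iff p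
  by_contra hcon
  obtain ⟨α, hα, hα0⟩ := Submodule.exists_dual_map_eq_bot_of_notMem hcon inferInstance
  have hαx : ∀ x : Fin n → F, α x = ∑ s, x s * α (Pi.single s 1) := fun x => by
    rw [LinearMap.pi_apply_eq_sum_univ α x]
    refine Finset.sum_congr rfl fun s _ => ?_
    rw [smul_eq_mul]
    congr 2
    ext t
    simp [Pi.single_apply, eq_comm]
  obtain ⟨b, hb, a, ha⟩ := exists_common_denominator p fun s => α (Pi.single s 1)
  have hclear : ∀ v : Fin n → MvPolynomial σ ℂ,
      ψ (∑ s, v s * a s) = ψ b * α (fun s => ψ (v s)) := fun v => by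
    rw [hαx, map_sum, Finset.mul_sum]
    refine Finset.sum_congr rfl fun s _ => ?_
    rw [map_mul, show ψ (a s) = _ from ha s]
    ring
  have hP : ∀ i, ∑ s, P i s * a s ∈ p := fun i => by
    rw [← hψ, hclear]
    have h0 : α (fun s => ψ (P i s)) ∈ Submodule.map α (Submodule.span F
        (Set.range fun i s => ψ (P i s))) :=
      Submodule.mem_map_of_mem (Submodule.subset_span ⟨i, rfl⟩)
    have h1 : α (fun s => ψ (P i s)) = 0 := (Submodule.mem_bot F).1 (hα0 ▸ h0)
    rw [h1, mul_zero]
  have hne : ∑ s, u s * a s ∉ p := fun hmem => by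
    rw [← hψ, hclear, mul_eq_zero, hψ] at hmem
    exact hmem.elim hb hα
  have hprod : h * ∑ s, u s * a s ∉ p := fun hmem =>
    (Ideal.IsPrime.mem_or_mem ‹_› hmem).elim hh hne
  refine hprod (hp _ fun z hz => ?_)
  by_contra hz0
  rw [map_mul, mul_eq_zero, not_or] at hz0
  obtain ⟨c, hc⟩ := (Submodule.mem_span_range_iff_exists_fun ℂ).1 (hu z hz)
  have hPz : ∀ i, ∑ s, MvPolynomial.eval z (P i s) * MvPolynomial.eval z (a s) = 0 := fun i => by
    have h0 := (mul_eq_zero.1 (hmul _ (hP i) z hz)).resolve_left hz0.1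
    simpa using h0
  refine hz0.2 ?_
  have hus : ∀ s, MvPolynomial.eval z (u s) = ∑ i, c i * MvPolynomial.eval z (P i s) := fun s => by
    have := congrFun hc s
    simpa using this.symm
  simp only [map_sum, map_mul, hus, Finset.sum_mul]
  rw [Finset.sum_comm]
  refine Finset.sum_eq_zero fun i _ => ?_
  have := congrArg (c i * ·) (hPz i)
  simpa [Finset.mul_sum, mul_assoc] using this

theorem eval_euler_eq_zero {n : ℕ} {X : Set (Fin n → ℂ)} (hX : IsCone X)
    {g : MvPolynomial (Fin n) ℂ} (hg : ∀ y ∈ X, MvPolynomial.eval y g = 0) {x : Fin n → ℂ}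
    (hx : x ∈ X) : ∑ s, MvPolynomial.eval x (MvPolynomial.pderiv s g) * x s = 0 := by
  rw [← MvPolynomial.fderiv_eval_apply]
  have hA : HasDerivAt (fun t : ℂ => t • x) ((1 : ℂ) • x) 1 := (hasDerivAt_id (1 : ℂ)).smul_const x
  have h1 := (MvPolynomial.hasFDerivAt_eval g ((1 : ℂ) • x)).comp_hasDerivAt (1 : ℂ) hA
  have h2 : (fun y => MvPolynomial.eval y g) ∘ (fun t : ℂ => t • x) = fun _ => 0 :=
    funext fun t => hg _ (hX.2 t x hx)
  rw [h2] at h1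
  have h3 := h1.unique (hasDerivAt_const (1 : ℂ) (0 : ℂ))
  rw [one_smul] at h3
  rw [(MvPolynomial.hasFDerivAt_eval g x).fderiv]
  exact h3

/-- The infinitesimal form of Terracini's lemma at a generic point: the identity decomposes into a
part landing in the sum of the tangent spaces at the points `Q i` and a part composed of
differentials at `U` of elements of `I`. -/
theorem exists_generic_decomposition {κ n : ℕ} {F : Type} [Field F] [Algebra ℂ F]
    (I : Ideal (MvPolynomial (Fin n) ℂ)) (G : Set (MvPolynomial (Fin n) ℂ))
    (U : Fin n → F) (Q : Fin κ → Fin n → F)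
    (hI : ∀ f, MvPolynomial.aeval U f = 0 → ∃ h, MvPolynomial.aeval U h ≠ 0 ∧ h * f ∈ I)
    (hU : U ∈ Submodule.span F (Set.range Q))
    (hG : ∀ g ∈ G, ∀ i, MvPolynomial.aeval (Q i) g = 0)
    (heuler : ∀ g ∈ G, ∀ i,
      ∑ t, MvPolynomial.aeval (Q i) (MvPolynomial.pderiv t g) * Q i t = 0) :
    ∃ (v : Fin n → Fin κ → Fin n → F) (B : Finset I) (l : Fin n → I → F),
      (∀ g ∈ G, ∀ s i, ∑ t, MvPolynomial.aeval (Q i) (MvPolynomial.pderiv t g) * v s i t = 0) ∧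
      ∀ t s, (if t = s then 1 else 0) = ∑ i, v s i t +
        ∑ f ∈ B, l t f * MvPolynomial.aeval U (MvPolynomial.pderiv s f.1) := by
  obtain ⟨c, hc⟩ := (Submodule.mem_span_range_iff_exists_fun F).1 hU
  obtain ⟨M, B, l, hM, hl⟩ := exists_matrix_of_linear_forms
    fun (f : I) s => MvPolynomial.aeval U (MvPolynomial.pderiv s f.1)
  have hder : ∀ s, ∃ D : Derivation ℂ F F, ∀ t, D (U t) = M t s := fun s => by
    refine exists_derivation_of_annihilates U (fun t => M t s) fun f hf => ?_
    obtain ⟨h, hh, hhf⟩ := hI f hf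
    have h0 := hM ⟨h * f, hhf⟩ s
    simp only [Derivation.leibniz, smul_eq_mul, map_add, map_mul, hf, zero_mul, add_zero,
      mul_assoc, ← Finset.mul_sum] at h0
    exact (mul_eq_zero.1 h0).resolve_left hh
  choose D hD using hder
  refine ⟨fun s i t => D s (c i) * Q i t + c i * D s (Q i t), B, l, fun g hg s i => ?_,
    fun t s => ?_⟩
  · have h2 := Derivation.map_mvPolynomial_aeval (D s) (Q i) g
    rw [hG g hg i, map_zero] at h2
    calc _ = D s (c i) * ∑ t, MvPolynomial.aeval (Q i) (MvPolynomial.pderiv t g) * Q i t +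
          c i * ∑ t, MvPolynomial.aeval (Q i) (MvPolynomial.pderiv t g) * D s (Q i t) := by
            rw [Finset.mul_sum, Finset.mul_sum, ← Finset.sum_add_distrib]
            exact Finset.sum_congr rfl fun t _ => by ring
      _ = 0 := by rw [heuler g hg i, ← h2, mul_zero, mul_zero, add_zero]
  · rw [hl t s, ← hD s t, ← hc]
    simp [Derivation.leibniz, mul_comm]

theorem MvPolynomial.eval_aeval {σ τ : Type*} (z : σ → ℂ) (w : τ → MvPolynomial σ ℂ)
    (g : MvPolynomial τ ℂ) :
    MvPolynomial.eval z (MvPolynomial.aeval w g) =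
      MvPolynomial.eval (fun s => MvPolynomial.eval z (w s)) g := by
  induction g using MvPolynomial.induction_on with
  | C a => simp
  | add p q hp hq => rw [map_add, map_add, hp, hq, map_add]
  | mul_X p s hp =>
    rw [map_mul, map_mul, hp, MvPolynomial.aeval_X, map_mul, MvPolynomial.eval_X]

theorem smul_eq_sum_of_decomposition {ι κ n : Type*} [Fintype ι] [Fintype κ] [Fintype n]
    [DecidableEq n] {β : ℂ} {T : n → κ → n → ℂ} {a : n → ι → ℂ} {e : ι → n → ℂ} {x : n → ℂ}
    (h : ∀ t s, (if t = s then β else 0) = ∑ i, T s i t + ∑ f, a t f * e f s)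
    (he : ∀ f, ∑ s, e f s * x s = 0) : β • x = ∑ s, ∑ i, x s • T s i := by
  funext t
  have h1 : ∑ s, (∑ f, a t f * e f s) * x s = 0 := by
    simp_rw [Finset.sum_mul]
    rw [Finset.sum_comm]
    simp_rw [mul_assoc, ← Finset.mul_sum, he, mul_zero, Finset.sum_const_zero]
  calc (β • x) t = ∑ s, (if t = s then β else 0) * x s := by simp
    _ = ∑ s, (∑ i, T s i t) * x s + ∑ s, (∑ f, a t f * e f s) * x s := by
      simp_rw [h, add_mul, Finset.sum_add_distrib]
    _ = _ := by
      rw [h1, add_zero]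
      simp [mul_comm (x _), Finset.sum_mul]

theorem exists_generic_tangSp_sec_subset {n k : ℕ} {X : Set (Fin n → ℂ)} (hX : IsCone X) :
    ∃ H : MvPolynomial ((Fin (k + 1) × Fin n) ⊕ Fin n) ℂ,
      (∃ (P : Fin (k + 1) → Fin n → ℂ) (u : Fin n → ℂ), (∀ i, P i ∈ X) ∧
        u ∈ Submodule.span ℂ (Set.range P) ∧
        MvPolynomial.eval (Sum.elim (fun q => P q.1 q.2) u) H ≠ 0) ∧
      ∀ (P : Fin (k + 1) → Fin n → ℂ) (u : Fin n → ℂ), (∀ i, P i ∈ X) →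
        u ∈ Submodule.span ℂ (Set.range P) →
        MvPolynomial.eval (Sum.elim (fun q => P q.1 q.2) u) H ≠ 0 →
        TangSp (Sec X k) u ⊆ Submodule.span ℂ (⋃ i, TangSp X (P i)) := by
  classical
  let σ := (Fin (k + 1) × Fin n) ⊕ Fin n
  let R := MvPolynomial σ ℂ
  let V : Set (σ → ℂ) := {z | (∀ i, (fun s => z (.inl (i, s))) ∈ X) ∧
    (fun s => z (.inr s)) ∈ Submodule.span ℂ (Set.range fun i s => z (.inl (i, s)))}
  let xP : Fin (k + 1) → Fin n → R := fun i s => MvPolynomial.X (.inl (i, s))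
  let xu : Fin n → R := fun s => MvPolynomial.X (.inr s)
  let J : Ideal R := MvPolynomial.vanishingIdeal ℂ V
  have hJmem : ∀ f, f ∈ J ↔ ∀ z ∈ V, MvPolynomial.eval z f = 0 := fun f => Iff.rfl
  have hJrad : J.IsRadical := fun f ⟨m, hm⟩ => by
    rw [hJmem] at hm ⊢
    intro z hz
    have h0 := hm z hz
    rw [map_pow] at h0
    by_contra hne
    exact pow_ne_zero m hne h0
  have hevP : ∀ (z : σ → ℂ) i (g : MvPolynomial (Fin n) ℂ),
      MvPolynomial.eval z (MvPolynomial.aeval (xP i) g) =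
        MvPolynomial.eval (fun s => z (.inl (i, s))) g := fun z i g => by
    rw [MvPolynomial.eval_aeval]
    simp only [xP, MvPolynomial.eval_X]
  have hevu : ∀ (z : σ → ℂ) (g : MvPolynomial (Fin n) ℂ),
      MvPolynomial.eval z (MvPolynomial.aeval xu g) =
        MvPolynomial.eval (fun s => z (.inr s)) g := fun z g => by
    rw [MvPolynomial.eval_aeval]
    simp only [xu, MvPolynomial.eval_X]
  let I : Ideal (MvPolynomial (Fin n) ℂ) := J.comap (MvPolynomial.aeval xu : _ →ₐ[ℂ] R).toRingHom
  have hImem : ∀ f, f ∈ I ↔ MvPolynomial.aeval xu f ∈ J := fun f => Iff.rfl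
  have hIsec : ∀ f ∈ I, ∀ y ∈ Sec X k, MvPolynomial.eval y f = 0 := fun f hf => by
    rw [eval_eq_zero_on_sec_iff]
    intro P hP u hu
    have h := (hJmem _).1 ((hImem f).1 hf) (Sum.elim (fun q => P q.1 q.2) u) ⟨hP, hu⟩
    rwa [hevu] at h
  have hIne : I ≠ ⊤ := fun htop => by
    have h1 : (1 : MvPolynomial (Fin n) ℂ) ∈ I := htop ▸ Submodule.mem_top
    rw [hImem, map_one, hJmem] at h1
    have h0 : (0 : σ → ℂ) ∈ V := ⟨fun i => hX.1, Submodule.zero_mem _⟩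
    simpa using h1 0 h0
  have hIrad : I.IsRadical := hJrad.comap _
  obtain ⟨q, hq⟩ := Ideal.nonempty_minimalPrimes hIne
  obtain ⟨p, hpJ, hpq⟩ := Ideal.exists_minimalPrimes_comap_eq
    (MvPolynomial.aeval xu : _ →ₐ[ℂ] R).toRingHom q hq
  have hpprime : p.IsPrime := hpJ.1.1
  obtain ⟨h, hh, hmulJ⟩ := Ideal.exists_notMem_forall_mul_mem_of_mem_minimalPrimes hJrad hpJ
  obtain ⟨h', hh', hmulI⟩ := Ideal.exists_notMem_forall_mul_mem_of_mem_minimalPrimes hIrad hq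
  let F := FractionRing (R ⧸ p)
  let ψ : R →ₐ[ℂ] F := IsScalarTower.toAlgHom ℂ R F
  have hψ : ∀ f, ψ f = 0 ↔ f ∈ p := fun f => algebraMap_fractionRing_quotient_eq_zero_iff p
  have hJp : J ≤ p := hpJ.1.2
  have hmul : ∀ f ∈ p, ∀ z ∈ V, MvPolynomial.eval z h * MvPolynomial.eval z f = 0 :=
    fun f hf z hz => by
      rw [← map_mul]
      exact (hJmem _).1 (hmulJ f hf) z hz
  let U : Fin n → F := fun s => ψ (xu s)
  let Q : Fin (k + 1) → Fin n → F := fun i s => ψ (xP i s)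
  have hψu : ∀ f, MvPolynomial.aeval U f = ψ (MvPolynomial.aeval xu f) := fun f => by
    rw [← MvPolynomial.comp_aeval_apply]
  have hψP : ∀ i f, MvPolynomial.aeval (Q i) f = ψ (MvPolynomial.aeval (xP i) f) := fun i f => by
    rw [← MvPolynomial.comp_aeval_apply]
  have hspan : U ∈ Submodule.span F (Set.range Q) :=
    mem_span_functionField hh hmul (fun f hf => hJp ((hJmem f).2 hf)) xP xu fun z hz => by
      simpa [xu, xP] using hz.2
  obtain ⟨v, B, l, hv, hl⟩ := exists_generic_decomposition I
    {g | ∀ y ∈ X, MvPolynomial.eval y g = 0} U Q (fun f hf => by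
      rw [hψu, hψ] at hf
      refine ⟨h', fun h0 => hh' ?_, hmulI f (hpq ▸ hf)⟩
      rw [hψu, hψ] at h0
      exact hpq ▸ h0) hspan (fun g hg i => by
      rw [hψP, hψ]
      refine hJp ((hJmem _).2 fun z hz => ?_)
      rw [hevP]
      exact hg _ (hz.1 i)) (fun g hg i => by
      have hmem : ∑ t, MvPolynomial.aeval (xP i) (MvPolynomial.pderiv t g) * xP i t ∈ J := by
        rw [hJmem]
        intro z hz
        simpa [hevP, xP] using eval_euler_eq_zero hX hg (hz.1 i)
      have h0 := (hψ _).2 (hJp hmem)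
      simpa [hψP, Q] using h0)
  obtain ⟨b, hb, A, hA⟩ := exists_common_denominator p
    (Sum.elim (fun a => v a.1 a.2.1 a.2.2) fun a : Fin n × B => l a.1 a.2 :
      (Fin n × Fin (k + 1) × Fin n) ⊕ (Fin n × B) → F)
  have hAv : ∀ s i t, ψ (A (.inl (s, i, t))) = ψ b * v s i t := fun s i t => hA (.inl (s, i, t))
  have hAl : ∀ t (f : B), ψ (A (.inr (t, f))) = ψ b * l t f := fun t f => hA (.inr (t, f))
  have hid : ∀ t s, (if t = s then b else 0) - ∑ i, A (.inl (s, i, t)) -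
      ∑ f : B, A (.inr (t, f)) * MvPolynomial.aeval xu (MvPolynomial.pderiv s f.1.1) ∈ p := by
    intro t s
    rw [← hψ]
    have h0 : ψ (if t = s then b else 0) = ψ b * (if t = s then 1 else 0) := by
      split_ifs <;> simp
    rw [map_sub, map_sub, map_sum, map_sum, h0, hl t s, mul_add, Finset.mul_sum, Finset.mul_sum,
      ← Finset.sum_coe_sort B]
    simp only [map_mul, hAv, hAl, ← hψu, mul_assoc]
    ring
  have htan : ∀ g : MvPolynomial (Fin n) ℂ, (∀ y ∈ X, MvPolynomial.eval y g = 0) → ∀ s i,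
      ∑ t, MvPolynomial.aeval (xP i) (MvPolynomial.pderiv t g) * A (.inl (s, i, t)) ∈ p := by
    intro g hg s i
    rw [← hψ]
    rw [map_sum, ← mul_zero (ψ b), ← hv g hg s i, Finset.mul_sum]
    refine Finset.sum_congr rfl fun t _ => ?_
    rw [map_mul, hAv, hψP]
    ring
  refine ⟨h * b, ?_, ?_⟩
  · have hhb : h * b ∉ J := fun hmem => (hpprime.mem_or_mem (hJp hmem)).elim hh hb
    rw [hJmem] at hhb
    push Not at hhb
    obtain ⟨z, hz, hz0⟩ := hhb
    refine ⟨fun i s => z (.inl (i, s)), fun s => z (.inr s), hz.1, hz.2, ?_⟩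
    convert hz0 using 2
    congr 1
    ext a
    rcases a with a | a <;> rfl
  · intro P u hP hu hH x hx
    set z : σ → ℂ := Sum.elim (fun q => P q.1 q.2) u with hzdef
    have hz : z ∈ V := ⟨hP, hu⟩
    rw [map_mul, mul_ne_zero_iff] at hH
    have hp0 : ∀ f ∈ p, MvPolynomial.eval z f = 0 := fun f hf =>
      (mul_eq_zero.1 (hmul f hf z hz)).resolve_left hH.1
    rw [mem_tangSp_iff] at hx
    let T : Fin n → Fin (k + 1) → Fin n → ℂ := fun s i t => MvPolynomial.eval z (A (.inl (s, i, t)))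
    have hT : ∀ s i, T s i ∈ TangSp X (P i) := fun s i => by
      rw [mem_tangSp_iff]
      intro g hg
      have h0 := hp0 _ (htan g hg s i)
      simp only [map_sum, map_mul, hevP] at h0
      exact h0
    have hbx : MvPolynomial.eval z b • x = ∑ s, ∑ i, x s • T s i := by
      refine smul_eq_sum_of_decomposition
        (a := fun t (f : B) => MvPolynomial.eval z (A (.inr (t, f))))
        (e := fun f s => MvPolynomial.eval u (MvPolynomial.pderiv s f.1.1)) (fun t s => ?_)
        fun f => hx f.1.1 (hIsec _ f.1.2)
      have h0 := hp0 _ (hid t s)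
      simp only [map_sub, map_sum, map_mul, hevu, apply_ite (MvPolynomial.eval z), map_zero] at h0
      rw [sub_sub, sub_eq_zero] at h0
      exact h0
    rw [← inv_smul_smul₀ hH.2 x, hbx]
    exact Submodule.smul_mem _ _ (Submodule.sum_mem _ fun s _ => Submodule.sum_mem _ fun i _ =>
      Submodule.smul_mem _ _ (Submodule.subset_span (Set.mem_iUnion.2 ⟨i, hT s i⟩)))

/-- **Terracini's Lemma.** For general points `P_0, …, P_k` of a reduced (possibly
reducible) projective variety `X` and a general point `u` of their span, the embedded
tangent space of `S_k(X)` at `u` is the linear span of the tangent spaces `T_{P_i}X`. -/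
theorem terracini (r k : ℕ) (X : Set (Fin (r + 1) → ℂ))
    (halg : IsAlgSet X) (hcone : IsCone X) :
    ∃ Z : Set ((Fin (k + 1) → Fin (r + 1) → ℂ) × (Fin (r + 1) → ℂ)), IsAlgSet Z ∧
      ¬ ({Pu : (Fin (k + 1) → Fin (r + 1) → ℂ) × (Fin (r + 1) → ℂ) |
          (∀ i, Pu.1 i ∈ X) ∧ Pu.2 ∈ Submodule.span ℂ (Set.range Pu.1)} ⊆ Z) ∧
      ∀ (P : Fin (k + 1) → Fin (r + 1) → ℂ) (u : Fin (r + 1) → ℂ),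
        (∀ i, P i ∈ X) → u ∈ Submodule.span ℂ (Set.range P) → (P, u) ∉ Z →
        TangSp (Sec X k) u =
          (Submodule.span ℂ (⋃ i, TangSp X (P i)) : Set (Fin (r + 1) → ℂ)) := by
  classical
  obtain ⟨H, ⟨P₀, u₀, hP₀, hu₀, hH₀⟩, hH⟩ := exists_generic_tangSp_sec_subset (k := k) hcone
  let ℓ : ((Fin (k + 1) × Fin (r + 1)) ⊕ Fin (r + 1)) →
      ((Fin (k + 1) → Fin (r + 1) → ℂ) × (Fin (r + 1) → ℂ)) →ₗ[ℂ] ℂ :=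
    Sum.elim
      (fun q => LinearMap.proj q.2 ∘ₗ LinearMap.proj q.1 ∘ₗ LinearMap.fst ℂ _ _)
      (fun s => LinearMap.proj s ∘ₗ LinearMap.snd ℂ _ _)
  have hℓ : ∀ w : (Fin (k + 1) → Fin (r + 1) → ℂ) × (Fin (r + 1) → ℂ),
      (fun s => ℓ s w) = Sum.elim (fun q => w.1 q.1 q.2) w.2 := fun w => by
    ext s
    rcases s with s | s <;> rfl
  refine ⟨{w | MvPolynomial.eval (fun s => ℓ s w) H = 0},
    ⟨{fun w => MvPolynomial.eval (fun s => ℓ s w) H}, ?_, by simp⟩, fun hsub => ?_, ?_⟩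
  · simpa using eval_linear_mem_polyFun ℓ H
  · refine hH₀ ?_
    have h0 := hsub (show (P₀, u₀) ∈ {Pu : (Fin (k + 1) → Fin (r + 1) → ℂ) × (Fin (r + 1) → ℂ) |
      (∀ i, Pu.1 i ∈ X) ∧ Pu.2 ∈ Submodule.span ℂ (Set.range Pu.1)} from ⟨hP₀, hu₀⟩)
    rwa [Set.mem_ofPred_eq, hℓ] at h0
  · intro P u hP hu hZ
    rw [Set.mem_ofPred_eq, hℓ] at hZ
    refine Set.Subset.antisymm (hH P u hP hu hZ) ?_
    have hle : Submodule.span ℂ (⋃ i, TangSp X (P i)) ≤ tangSubmodule (Sec X k) u :=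
      Submodule.span_le.2 (Set.iUnion_subset fun i => tangSp_subset_tangSp_sec hP hu i)
    exact hle
end
end

section
/- Let X ⊂ P^r be an irreducible non-degenerate curve such that any two tangent lines at general (smooth) points of X intersect. Then X is degenerate, contradiction; i.e., for a non-degenerate irreducible curve there exist two disjoint tangent lines. -/
open Submodule

noncomputable section

section

open Module

lemma Derivation.exists_lift_of_surjective {k B A M : Type*} [CommRing k] [CommRing B] [CommRing A]
    [AddCommGroup M] [Algebra k B] [Algebra k A] [Algebra B A] [IsScalarTower k B A] [Module k M]
    [Module B M] [Module A M] [IsScalarTower B A M]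
    (hsurj : Function.Surjective (algebraMap B A)) (D : Derivation k B M)
    (hD : ∀ b, algebraMap B A b = 0 → D b = 0) :
    ∃ D' : Derivation k A M, ∀ b, D' (algebraMap B A b) = D b := by
  have key : ∀ b, D (Function.surjInv hsurj (algebraMap B A b)) = D b := fun b => by
    rw [← sub_eq_zero, ← map_sub]
    apply hD
    rw [map_sub, Function.surjInv_eq hsurj, sub_self]
  refine ⟨Derivation.mk'
    { toFun := fun a => D (Function.surjInv hsurj a)
      map_add' := fun a b => ?_
      map_smul' := fun c a => ?_ } ?_, key⟩
  · obtain ⟨a, rfl⟩ := hsurj a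
    obtain ⟨b, rfl⟩ := hsurj b
    rw [← map_add, key, key, key, map_add]
  · obtain ⟨a, rfl⟩ := hsurj a
    rw [← algebraMap_smul B c (algebraMap B A a), algebraMap_smul, ← Algebra.linearMap_apply,
      ← LinearMap.map_smul_of_tower, Algebra.linearMap_apply, key]
    simp [key]
  · intro a b
    obtain ⟨a, rfl⟩ := hsurj a
    obtain ⟨b, rfl⟩ := hsurj b
    change D (Function.surjInv hsurj _) =
      _ • D (Function.surjInv hsurj _) + _ • D (Function.surjInv hsurj _)
    rw [← map_mul, key, key, key]
    simp

lemma finrank_kaehlerDifferential_of_isIntegral {ι k A K : Type*} [Fintype ι] [Field k] [CharZero k]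
    [CommRing A] [IsDomain A] [Algebra k A] [Field K] [Algebra A K] [IsFractionRing A K]
    [Algebra k K] [IsScalarTower k A K] [Algebra (MvPolynomial ι k) A]
    [IsScalarTower k (MvPolynomial ι k) A] [Algebra.IsIntegral (MvPolynomial ι k) A]
    [FaithfulSMul (MvPolynomial ι k) A] :
    finrank K (Ω[K⁄k]) = Fintype.card ι := by
  let S := MvPolynomial ι k
  let F := FractionRing S
  let : Algebra S K := Algebra.compHom K (algebraMap S A)
  have : IsScalarTower S A K := IsScalarTower.of_algebraMap_eq fun _ => rfl
  have : IsScalarTower k S K := .of_algebraMap_eq fun x => by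
    rw [IsScalarTower.algebraMap_apply k A K, IsScalarTower.algebraMap_apply k S A]; rfl
  have : FaithfulSMul A K := IsFractionRing.instFaithfulSMul A K 
  have : FaithfulSMul S K := .trans S A K
  let : Algebra F K := FractionRing.liftAlgebra S K
  have : Algebra.IsAlgebraic A K := IsLocalization.isAlgebraic _ (nonZeroDivisors A)
  have : Algebra.IsAlgebraic S K := .trans S A K
  have : Algebra.IsAlgebraic F K :=
    IsFractionRing.comap_isAlgebraic_iff.mp ‹Algebra.IsAlgebraic S K›
  have : CharZero F := inferInstance
  have : Algebra.FormallyEtale F K := .of_isSeparable F K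
  have : Algebra.FormallyEtale S F := .of_isLocalization (nonZeroDivisors S)
  have : Algebra.FormallyEtale S K := .comp S F K
  rw [← (KaehlerDifferential.tensorKaehlerEquivOfFormallyEtale k S K).finrank_eq,
    Module.finrank_baseChange,
    Module.finrank_eq_card_basis (KaehlerDifferential.mvPolynomialBasis k ι)]


/-- The Zariski tangent space at the `F`-point `ψ` of affine space of the subscheme cut out by
the ideal `I`. -/
def tangentAt {σ k F : Type*} [Fintype σ] [CommRing k] [CommRing F]
    (I : Ideal (MvPolynomial σ k)) (ψ : MvPolynomial σ k →+* F) : Submodule F (σ → F) where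
  carrier := {w | ∀ P ∈ I, ∑ i, ψ (MvPolynomial.pderiv i P) * w i = 0}
  zero_mem' := by simp
  add_mem' hv hw P hP := by simp [mul_add, Finset.sum_add_distrib, hv P hP, hw P hP]
  smul_mem' c w hw P hP := by
    simp [mul_left_comm _ c, ← Finset.mul_sum, hw P hP]

lemma mem_tangentAt {σ k F : Type*} [Fintype σ] [CommRing k] [CommRing F]
    {I : Ideal (MvPolynomial σ k)} {ψ : MvPolynomial σ k →+* F} {w : σ → F} :
    w ∈ tangentAt I ψ ↔ ∀ P ∈ I, ∑ i, ψ (MvPolynomial.pderiv i P) * w i = 0 := Iff.rfl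

lemma MvPolynomial.derivation_apply_eq_sum_pderiv {σ k M : Type*} [Fintype σ] [CommRing k]
    [AddCommGroup M] [Module k M] [Module (MvPolynomial σ k) M]
    [IsScalarTower k (MvPolynomial σ k) M] (D : Derivation k (MvPolynomial σ k) M)
    (P : MvPolynomial σ k) : D P = ∑ i, pderiv i P • D (X i) := by
  classical
  have hsum (f : σ → Derivation k (MvPolynomial σ k) M) (Q : MvPolynomial σ k) :
      (∑ i, f i) Q = ∑ i, f i Q := by
    rw [← Derivation.coeFnAddMonoidHom_apply, map_sum, Finset.sum_apply]
    rfl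
  have : D = ∑ i, ((LinearMap.toSpanSingleton _ M (D (X i))).compDer (pderiv i)) := by
    ext j
    simp [hsum, pderiv_X, Pi.single_apply]
  conv_lhs => rw [this]
  simp [hsum]

lemma Derivation.eq_zero_of_isFractionRing {k A K : Type*} [CommRing k] [CommRing A] [IsDomain A]
    [Field K] [Algebra k K] [Algebra A K] [IsFractionRing A K]
    (D : Derivation k K K) (h : ∀ a, D (algebraMap A K a) = 0) : D = 0 := by
  ext x
  obtain ⟨a, b, hb, rfl⟩ := IsFractionRing.div_surjective (A := A) x
  have hb' : algebraMap A K b ≠ 0 := IsFractionRing.to_map_ne_zero_of_mem_nonZeroDivisors hb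
  have := D.leibniz (algebraMap A K a / algebraMap A K b) (algebraMap A K b)
  rw [div_mul_cancel₀ _ hb', h, h] at this
  simpa [hb'] using this.symm

lemma Derivation.exists_extend_isFractionRing {k A K : Type*} [CommRing k] [CommRing A] [IsDomain A]
    [Field K] [Algebra k A] [Algebra k K] [Algebra A K] [IsScalarTower k A K] [IsFractionRing A K]
    (D : Derivation k A K) : ∃ D' : Derivation k K K, ∀ a, D' (algebraMap A K a) = D a := by
  have : Algebra.FormallyEtale A K := .of_isLocalization (nonZeroDivisors A)
  refine ⟨((KaehlerDifferential.isBaseChange_of_formallyEtale k A K).lift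
    D.liftKaehlerDifferential).compDer (KaehlerDifferential.D k K), fun a => ?_⟩
  have := (KaehlerDifferential.isBaseChange_of_formallyEtale k A K).lift_eq
    D.liftKaehlerDifferential (KaehlerDifferential.D k A a)
  simpa using this

lemma finrank_tangentAt_generic {σ k A K : Type*} [Fintype σ] [Field k] [CommRing A] [IsDomain A]
    [Algebra k A] [Field K] [Algebra k K] [Algebra A K] [IsScalarTower k A K] [IsFractionRing A K]
    [Algebra (MvPolynomial σ k) A] [IsScalarTower k (MvPolynomial σ k) A]
    [Algebra (MvPolynomial σ k) K] [IsScalarTower (MvPolynomial σ k) A K]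
    (hsurj : Function.Surjective (algebraMap (MvPolynomial σ k) A)) :
    finrank K (tangentAt (RingHom.ker (algebraMap (MvPolynomial σ k) A))
      (algebraMap (MvPolynomial σ k) K)) = finrank K (Ω[K⁄k]) := by
  have : IsScalarTower k (MvPolynomial σ k) K := .of_algebraMap_eq fun x => by
    rw [IsScalarTower.algebraMap_apply k A K, IsScalarTower.algebraMap_apply k (MvPolynomial σ k) A,
      ← IsScalarTower.algebraMap_apply]
  let φ : Derivation k K K →ₗ[K] (σ → K) :=
    { toFun := fun D i => D (algebraMap _ K (MvPolynomial.X i : MvPolynomial σ k))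
      map_add' := fun _ _ => rfl
      map_smul' := fun _ _ => rfl }
  have hφ (D : Derivation k K K) (P : MvPolynomial σ k) :
      D (algebraMap _ K P) = ∑ i, algebraMap _ K (MvPolynomial.pderiv i P) * φ D i := by
    have := MvPolynomial.derivation_apply_eq_sum_pderiv
      (D.compAlgebraMap (MvPolynomial σ k)) P
    simpa [Algebra.smul_def, φ] using this
  have hinj : Function.Injective φ := by
    rw [injective_iff_map_eq_zero]
    intro D hD
    apply D.eq_zero_of_isFractionRing (A := A)
    intro a
    obtain ⟨P, rfl⟩ := hsurj a
    rw [← IsScalarTower.algebraMap_apply, hφ, hD]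
    simp
  have hrange : LinearMap.range φ = tangentAt (RingHom.ker (algebraMap (MvPolynomial σ k) A))
      (algebraMap (MvPolynomial σ k) K) := by
    apply le_antisymm
    · rintro _ ⟨D, rfl⟩ P hP
      rw [← hφ, IsScalarTower.algebraMap_apply _ A K, RingHom.mem_ker.mp hP, map_zero, map_zero]
    · intro w hw
      obtain ⟨D₁, hD₁⟩ := Derivation.exists_lift_of_surjective hsurj (MvPolynomial.mkDerivation k w)
        (fun P hP => by
          rw [MvPolynomial.derivation_apply_eq_sum_pderiv]
          simpa [Algebra.smul_def] using hw P hP)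
      obtain ⟨D₂, hD₂⟩ := D₁.exists_extend_isFractionRing
      refine ⟨D₂, funext fun i => ?_⟩
      change D₂ _ = _
      rw [IsScalarTower.algebraMap_apply _ A K, hD₂, hD₁, MvPolynomial.mkDerivation_X]
  rw [← hrange, LinearMap.finrank_range_of_inj hinj,
    ← (KaehlerDifferential.linearMapEquivDerivation k K (M := K)).finrank_eq]
  exact Subspace.dual_finrank_eq

lemma exists_specialization_linearIndependent {A K ι σ : Type*} (F : Type*) [CommRing A]
    [IsDomain A] [Field K] [Algebra A K] [IsFractionRing A K] [Field F] [Fintype ι] [Fintype σ]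
    (v : ι → σ → A)
    (hv : LinearIndependent K (fun j i => algebraMap A K (v j i))) :
    ∃ D : A, D ≠ 0 ∧ ∀ φ : A →+* F, φ D ≠ 0 → LinearIndependent F (fun j i => φ (v j i)) := by
  classical
  rw [linearIndependent_iff_injective_fintypeLinearCombination] at hv
  obtain ⟨g, hg⟩ := LinearMap.exists_leftInverse_of_injective _ (LinearMap.ker_eq_bot.mpr hv)
  have hgv (j l : ι) : ∑ i, algebraMap A K (v j i) * g (Pi.single i 1) l =
      if j = l then 1 else 0 := by
    have := congrFun (LinearMap.congr_fun hg (Pi.single j 1)) l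
    simp only [LinearMap.comp_apply, Fintype.linearCombination_apply_single, one_smul,
      LinearMap.id_apply] at this
    rw [pi_eq_sum_univ' (fun i => algebraMap A K (v j i))] at this
    simp only [map_sum, map_smul, Finset.sum_apply, Pi.smul_apply, smul_eq_mul] at this
    rw [this, Pi.single_apply]
    simp only [eq_comm]
  obtain ⟨b, hb⟩ := IsLocalization.exist_integer_multiples_of_finite (nonZeroDivisors A)
    (fun p : σ × ι => g (Pi.single p.1 1) p.2)
  choose N hN using hb
  have hNv (j l : ι) : ∑ i, v j i * N (i, l) = if j = l then (b : A) else 0 := by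
    apply IsFractionRing.injective A K
    simp only [map_sum, map_mul, hN, Algebra.smul_def, mul_left_comm _ (algebraMap A K b),
      ← Finset.mul_sum, hgv]
    split_ifs <;> simp
  refine ⟨b, nonZeroDivisors.coe_ne_zero b, fun φ hφ => ?_⟩
  rw [Fintype.linearIndependent_iff]
  intro c hc l
  have h1 : ∑ j, c j * ∑ i, φ (v j i) * φ (N (i, l)) = 0 := by
    simp only [Finset.mul_sum]
    rw [Finset.sum_comm]
    refine Finset.sum_eq_zero fun i _ => ?_
    have := congrFun hc i
    simp only [Finset.sum_apply, Pi.smul_apply, smul_eq_mul, Pi.zero_apply] at this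
    simp only [← mul_assoc, ← Finset.sum_mul, this, zero_mul]
  simp only [← map_mul, ← map_sum, hNv] at h1
  simpa [apply_ite φ, hφ] using h1

lemma finrank_ker_mulVecLin_of_linearIndependent {F ι σ : Type*} [Field F] [Fintype ι] [Fintype σ]
    (M : Matrix ι σ F) (hM : LinearIndependent F M.row) :
    finrank F (LinearMap.ker M.mulVecLin) + Fintype.card ι = Fintype.card σ := by
  have := LinearMap.finrank_range_add_finrank_ker M.mulVecLin
  rw [← Matrix.rank, hM.rank_matrix, Module.finrank_fintype_fun_eq_card] at this
  omega

lemma exists_finrank_tangentAt_eq {σ k A : Type*} (K F : Type*) [Fintype σ] [Field k]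
    [CommRing A] [IsDomain A] [Field K] [Algebra A K] [IsFractionRing A K]
    [Algebra (MvPolynomial σ k) A] [Algebra (MvPolynomial σ k) K]
    [IsScalarTower (MvPolynomial σ k) A K] [Field F]
    (hsurj : Function.Surjective (algebraMap (MvPolynomial σ k) A)) :
    ∃ D : MvPolynomial σ k, algebraMap _ A D ≠ 0 ∧ ∀ φ : A →+* F, φ (algebraMap _ A D) ≠ 0 →
      finrank F (tangentAt (RingHom.ker (algebraMap (MvPolynomial σ k) A))
        (φ.comp (algebraMap (MvPolynomial σ k) A))) =
      finrank K (tangentAt (RingHom.ker (algebraMap (MvPolynomial σ k) A))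
        (algebraMap (MvPolynomial σ k) K)) := by
  set I := RingHom.ker (algebraMap (MvPolynomial σ k) A) with hI
  let T := tangentAt I (algebraMap (MvPolynomial σ k) K)
  let B := Module.finBasis K T
  obtain ⟨b, hb⟩ := IsLocalization.exist_integer_multiples_of_finite (nonZeroDivisors A)
    (fun p : Fin (finrank K T) × σ => (B p.1 : σ → K) p.2)
  choose N hN using hb
  have hb0 : algebraMap A K b ≠ 0 := IsFractionRing.to_map_ne_zero_of_mem_nonZeroDivisors b.2
  have hindep : LinearIndependent K (fun j i => algebraMap A K (N (j, i))) := by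
    have h1 : LinearIndependent K (fun j => (B j : σ → K)) :=
      B.linearIndependent.map' T.subtype T.ker_subtype
    convert h1.units_smul (fun _ => Units.mk0 _ hb0) using 1
    ext j i
    simp [hN, Algebra.smul_def, Units.smul_def]
  obtain ⟨D₁, hD₁, hD₁'⟩ := exists_specialization_linearIndependent F (fun j i => N (j, i)) hindep
  let s : Set (σ → K) := {v | ∃ P ∈ I, v = fun i => algebraMap _ K (MvPolynomial.pderiv i P)}
  obtain ⟨g, hgs, hgspan, hgi⟩ := Submodule.exists_fun_fin_finrank_span_eq K s
  choose P hPI hPg using hgs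
  have hker : LinearMap.ker (Matrix.mulVecLin (Matrix.of g)) = T := by
    apply le_antisymm
    · intro w hw Q hQ
      have hQ' : (fun i => algebraMap _ K (MvPolynomial.pderiv i Q)) ∈
          Submodule.span K (Set.range g) := by
        rw [hgspan]
        exact Submodule.subset_span ⟨Q, hQ, rfl⟩
      change (fun i => algebraMap _ K (MvPolynomial.pderiv i Q)) ⬝ᵥ w = 0
      generalize (fun i => algebraMap _ K (MvPolynomial.pderiv i Q)) = u at hQ'
      induction hQ' using Submodule.span_induction with
      | mem x hx => 
        obtain ⟨j, rfl⟩ := hx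
        exact congrFun hw j
      | zero => simp
      | add x y _ _ hx hy => simp [add_dotProduct, hx, hy]
      | smul c x _ hx => simp [smul_dotProduct, hx]
    · intro w hw
      rw [LinearMap.mem_ker]
      ext j
      simpa [hPg, Matrix.mulVec, dotProduct] using hw (P j) (hPI j)
  have hcard := finrank_ker_mulVecLin_of_linearIndependent (Matrix.of g) hgi
  rw [hker] at hcard
  obtain ⟨D₂, hD₂, hD₂'⟩ := exists_specialization_linearIndependent (K := K) F
    (fun j i => algebraMap _ A (MvPolynomial.pderiv i (P j))) (by
      have : g = fun j i => algebraMap A K (algebraMap _ A (MvPolynomial.pderiv i (P j))) :=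
        funext fun j => by simp only [hPg, ← IsScalarTower.algebraMap_apply]
      rwa [this] at hgi)
  obtain ⟨D, hD⟩ := hsurj (D₁ * D₂)
  refine ⟨D, by simpa [hD] using ⟨hD₁, hD₂⟩, fun φ hφ => ?_⟩
  rw [hD, map_mul, mul_ne_zero_iff] at hφ
  apply le_antisymm
  · have h2 := finrank_ker_mulVecLin_of_linearIndependent (Matrix.of fun j i =>
      φ (algebraMap _ A (MvPolynomial.pderiv i (P j)))) (hD₂' φ hφ.2)
    have h3 : tangentAt I (φ.comp (algebraMap (MvPolynomial σ k) A)) ≤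
        LinearMap.ker (Matrix.mulVecLin (Matrix.of fun j i =>
          φ (algebraMap _ A (MvPolynomial.pderiv i (P j))))) := by
      intro w hw
      rw [LinearMap.mem_ker]
      ext j
      simpa [Matrix.mulVec, dotProduct] using hw (P j) (hPI j)
    have := Submodule.finrank_mono h3
    change _ ≤ finrank K T
    omega
  · have hmem (j) : (fun i => φ (N (j, i))) ∈ tangentAt I (φ.comp (algebraMap _ A)) := by
      intro Q hQ
      have h0 : ∑ i, algebraMap _ A (MvPolynomial.pderiv i Q) * N (j, i) = 0 := by
        apply IsFractionRing.injective A K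
        have := (B j).2 Q hQ
        simp only [map_sum, map_mul, hN, Algebra.smul_def, map_zero,
          ← IsScalarTower.algebraMap_apply, mul_left_comm _ (algebraMap A K b)]
        rw [← Finset.mul_sum, this, mul_zero]
      simpa using congrArg φ h0
    have hli : LinearIndependent F fun j =>
        (⟨_, hmem j⟩ : tangentAt I (φ.comp (algebraMap (MvPolynomial σ k) A))) :=
      LinearIndependent.of_comp (Submodule.subtype _) (hD₁' φ hφ.1)
    simpa using hli.fintype_card_le_finrank

end

lemma Submodule.eq_span_pair_of_finrank_eq_two {F V : Type*} [Field F] [AddCommGroup V] [Module F V]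
    {T : Submodule F V} (hT : Module.finrank F T = 2) {a b : V} (ha : a ∈ T) (hb : b ∈ T)
    (ha0 : a ≠ 0) (hab : b ∉ span F {a}) : T = span F {a, b} := by
  have : FiniteDimensional F T := Module.finite_of_finrank_eq_succ hT
  have hli : LinearIndependent F ![a, b] := by
    rw [LinearIndependent.pair_iff' ha0]
    intro c hc
    exact hab (mem_span_singleton.mpr ⟨c, hc⟩)
  refine (Submodule.eq_of_le_of_finrank_eq (span_le.mpr ?_) ?_).symm
  · rintro x (rfl | rfl) <;> assumption
  · have := finrank_span_eq_card hli
    rw [Matrix.range_cons_cons_empty, Fintype.card_fin] at this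
    rw [this, hT]

lemma Submodule.le_sup_of_finrank_eq_two {F V : Type*} [Field F] [AddCommGroup V] [Module F V]
    {S T U : Submodule F V} {v : V} (hU : Module.finrank F U = 2) (hv : S ⊓ T ≤ span F {v})
    (hvU : v ∉ U) (hUS : U ⊓ S ≠ ⊥) (hUT : U ⊓ T ≠ ⊥) : U ≤ S ⊔ T := by
  obtain ⟨a, ⟨haU, haS⟩, ha0⟩ := exists_mem_ne_zero_of_ne_bot hUS
  obtain ⟨b, ⟨hbU, hbT⟩, hb0⟩ := exists_mem_ne_zero_of_ne_bot hUT
  have hab : b ∉ span F {a} := by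
    intro h
    have hbS : b ∈ S := (span_singleton_le_iff_mem a S).mpr haS h
    obtain ⟨c, rfl⟩ := mem_span_singleton.mp (hv ⟨hbS, hbT⟩)
    have hc : c ≠ 0 := by rintro rfl; simp at hb0
    exact hvU ((smul_mem_iff U hc).mp hbU)
  rw [eq_span_pair_of_finrank_eq_two hU haU hbU ha0 hab, span_le]
  rintro x (rfl | rfl)
  · exact mem_sup_left haS
  · exact mem_sup_right hbT

/-- Pairwise intersecting lines in a projective space are concurrent or coplanar. -/
lemma Submodule.concurrent_or_coplanar {F V : Type*} [Field F] [AddCommGroup V] [Module F V]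
    [FiniteDimensional F V] (𝒯 : Set (Submodule F V)) (h𝒯 : 𝒯.Nonempty)
    (hdim : ∀ T ∈ 𝒯, Module.finrank F T = 2) (hmeet : ∀ S ∈ 𝒯, ∀ T ∈ 𝒯, S ⊓ T ≠ ⊥) :
    (∃ v ≠ 0, ∀ T ∈ 𝒯, v ∈ T) ∨ ∃ L : Submodule F V, Module.finrank F L ≤ 3 ∧ ∀ T ∈ 𝒯, T ≤ L := by
  by_cases hsub : 𝒯.Subsingleton
  · obtain ⟨T, hT⟩ := h𝒯
    exact .inr ⟨T, by simp [hdim T hT], fun U hU => (hsub hU hT).le⟩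
  obtain ⟨S, hS, T, hT, hne⟩ := Set.not_subsingleton_iff.mp hsub
  have hinf : Module.finrank F ↥(S ⊓ T) = 1 := by
    have h1 : 0 < Module.finrank F ↥(S ⊓ T) :=
      Nat.pos_of_ne_zero fun h => hmeet S hS T hT (Submodule.finrank_eq_zero.mp h)
    have h2 : S ⊓ T < S := by
      refine lt_of_le_of_ne inf_le_left fun h => hne ?_
      exact Submodule.eq_of_le_of_finrank_eq (inf_eq_left.mp h) (by rw [hdim S hS, hdim T hT])
    have := Submodule.finrank_lt_finrank_of_lt h2
    rw [hdim S hS] at this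
    omega
  obtain ⟨v, hv, hv0⟩ := exists_mem_ne_zero_of_ne_bot (hmeet S hS T hT)
  have hspan : S ⊓ T = span F {v} := by
    refine (Submodule.eq_of_le_of_finrank_eq ?_ ?_).symm
    · rwa [span_singleton_le_iff_mem]
    · rw [finrank_span_singleton hv0, hinf]
  by_cases hall : ∀ U ∈ 𝒯, v ∈ U
  · exact .inl ⟨v, hv0, hall⟩
  push Not at hall
  obtain ⟨U, hU, hvU⟩ := hall
  refine .inr ⟨S ⊔ T, ?_, fun Q hQ => ?_⟩
  · have := Submodule.finrank_sup_add_finrank_inf_eq S T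
    rw [hdim S hS, hdim T hT, hinf] at this
    omega
  · have hle (Q) (hQ : Q ∈ 𝒯) (hvQ : v ∉ Q) : Q ≤ S ⊔ T :=
      le_sup_of_finrank_eq_two (hdim Q hQ) hspan.le hvQ (hmeet Q hQ S hS) (hmeet Q hQ T hT)
    by_cases hvQ : v ∈ Q
    · obtain ⟨c, ⟨hcQ, hcU⟩, hc0⟩ := exists_mem_ne_zero_of_ne_bot (hmeet Q hQ U hU)
      have hcv : c ∉ span F {v} := by
        intro h
        obtain ⟨t, rfl⟩ := mem_span_singleton.mp h
        have ht : t ≠ 0 := by rintro rfl; simp at hc0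
        exact hvU ((smul_mem_iff U ht).mp hcU)
      rw [eq_span_pair_of_finrank_eq_two (hdim Q hQ) hvQ hcQ hv0 hcv, span_le]
      rintro x (rfl | rfl)
      · exact mem_sup_left hv.1
      · exact hle U hU hvU hcU
    · exact hle Q hQ hvQ

lemma mem_polyFun_iff {σ : Type*} [Fintype σ] {f : (σ → ℂ) → ℂ} :
    f ∈ PolyFun (σ → ℂ) ↔ ∃ P : MvPolynomial σ ℂ, ∀ x, f x = MvPolynomial.aeval x P := by
  classical
  constructor
  · intro hf
    induction hf using Algebra.adjoin_induction with
    | mem f hf =>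
      let l : (σ → ℂ) →ₗ[ℂ] ℂ := hf.mk' f
      refine ⟨∑ i, MvPolynomial.C (l (Pi.single i 1)) * MvPolynomial.X i, fun x => ?_⟩
      change l x = _
      conv_lhs => rw [LinearMap.pi_apply_eq_sum_univ l x]
      simp only [map_sum, map_mul, MvPolynomial.aeval_X, MvPolynomial.aeval_C, smul_eq_mul,
        mul_comm, Algebra.algebraMap_self, RingHom.id_apply]
      refine Finset.sum_congr rfl fun i _ => ?_
      congr 2
      ext j
      simp [Pi.single_apply, eq_comm]
    | algebraMap r => exact ⟨MvPolynomial.C r, fun x => by simp⟩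
    | add f g _ _ hf hg =>
      obtain ⟨P, hP⟩ := hf
      obtain ⟨Q, hQ⟩ := hg
      exact ⟨P + Q, fun x => by simp [hP, hQ]⟩
    | mul f g _ _ hf hg =>
      obtain ⟨P, hP⟩ := hf
      obtain ⟨Q, hQ⟩ := hg
      exact ⟨P * Q, fun x => by simp [hP, hQ]⟩
  · rintro ⟨P, hP⟩
    obtain rfl : f = fun x => MvPolynomial.aeval x P := funext hP
    clear hP
    induction P using MvPolynomial.induction_on with
    | C a =>
      simp only [MvPolynomial.aeval_C]
      exact (PolyFun (σ → ℂ)).algebraMap_mem a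
    | add P Q hP hQ =>
      simp only [map_add]
      exact (PolyFun (σ → ℂ)).add_mem hP hQ
    | mul_X P i hP =>
      simp only [map_mul, MvPolynomial.aeval_X]
      exact (PolyFun (σ → ℂ)).mul_mem hP
        (Algebra.subset_adjoin (LinearMap.proj (R := ℂ) (φ := fun _ : σ => ℂ) i).isLinear)

open MvPolynomial in
lemma isAlgSet_zeroLocus {σ : Type*} [Fintype σ] (J : Ideal (MvPolynomial σ ℂ)) :
    IsAlgSet (zeroLocus ℂ J) := by
  refine ⟨(fun P x => aeval x P) '' (J : Set (MvPolynomial σ ℂ)), ?_, ?_⟩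
  · rintro _ ⟨P, -, rfl⟩
    exact mem_polyFun_iff.mpr ⟨P, fun _ => rfl⟩
  · ext x
    simp [mem_zeroLocus_iff]

open MvPolynomial in
lemma IsAlgSet.zeroLocus_vanishingIdeal {σ : Type*} [Fintype σ] {X : Set (σ → ℂ)}
    (hX : IsAlgSet X) : zeroLocus ℂ (vanishingIdeal ℂ X) = X := by
  obtain ⟨S, hS, rfl⟩ := hX
  refine (zeroLocus_vanishingIdeal_le _).antisymm' fun x hx f hf => ?_
  obtain ⟨P, hP⟩ := mem_polyFun_iff.mp (hS hf)
  rw [hP]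
  exact hx P fun y hy => by rw [← hP]; exact hy f hf

open MvPolynomial in
lemma IsIrrAlg.isPrime_vanishingIdeal {σ : Type*} [Fintype σ] {X : Set (σ → ℂ)}
    (hX : IsIrrAlg X) : (vanishingIdeal ℂ X).IsPrime := by
  obtain ⟨⟨x, hx⟩, -, hirr⟩ := hX
  refine ⟨fun h => ?_, fun {P Q} hPQ => ?_⟩
  · have : (1 : MvPolynomial σ ℂ) ∈ vanishingIdeal ℂ X := h ▸ Submodule.mem_top
    simpa using this x hx
  · have key (P : MvPolynomial σ ℂ) (h : X ⊆ zeroLocus ℂ (Ideal.span {P})) :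
        P ∈ vanishingIdeal ℂ X := fun y hy => h hy P (Ideal.mem_span_singleton_self P)
    refine (hirr _ _ (isAlgSet_zeroLocus (Ideal.span {P})) (isAlgSet_zeroLocus (Ideal.span {Q}))
      fun y hy => ?_).imp (key P) (key Q)
    simpa [zeroLocus_span] using hPQ y hy

open MvPolynomial in
lemma isIrrAlg_zeroLocus {σ : Type*} [Fintype σ] (J : Ideal (MvPolynomial σ ℂ)) [hJ : J.IsPrime] :
    IsIrrAlg (zeroLocus ℂ J) := by
  have hvz := IsPrime.vanishingIdeal_zeroLocus (K := ℂ) J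
  refine ⟨?_, isAlgSet_zeroLocus J, fun Y Z hY hZ hYZ => ?_⟩
  · by_contra h
    rw [Set.not_nonempty_iff_eq_empty.mp h, vanishingIdeal_empty] at hvz
    exact hJ.ne_top hvz.symm
  · rw [← hY.zeroLocus_vanishingIdeal, ← hZ.zeroLocus_vanishingIdeal]
    have h : vanishingIdeal ℂ Y * vanishingIdeal ℂ Z ≤ J := by
      rw [← hvz, Ideal.mul_le]
      intro P hP Q hQ x hx
      rcases hYZ hx with h | h
      · rw [map_mul, hP x h, zero_mul]
      · rw [map_mul, hQ x h, mul_zero]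
    exact (hJ.mul_le.mp h).imp (fun h => zeroLocus_anti_mono h) (fun h => zeroLocus_anti_mono h)

open MvPolynomial in
lemma hasFDerivAt_aeval {σ : Type*} [Fintype σ] (P : MvPolynomial σ ℂ) (x : σ → ℂ) :
    HasFDerivAt (fun y : σ → ℂ => aeval y P)
      (∑ i, aeval x (pderiv i P) • ContinuousLinearMap.proj (R := ℂ) (φ := fun _ : σ => ℂ) i)
      x := by
  classical
  induction P using MvPolynomial.induction_on with
  | C a =>
    simp only [aeval_C]
    refine (hasFDerivAt_const (𝕜 := ℂ) a x).congr_fderiv ?_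
    ext w
    simp
  | add P Q hP hQ =>
    simp only [map_add]
    refine (hP.add hQ).congr_fderiv ?_
    ext w
    simp [add_mul, Finset.sum_add_distrib]
  | mul_X P i hP =>
    have := hP.mul (hasFDerivAt_apply (𝕜 := ℂ) i x)
    simp only [map_mul, aeval_X]
    refine this.congr_fderiv ?_
    ext w
    simp [Derivation.leibniz, pderiv_X, Pi.single_apply, add_mul, Finset.sum_add_distrib,
      Finset.mul_sum, mul_assoc, apply_ite]

open MvPolynomial in
lemma exists_chain_isIrrAlg_iff {σ : Type*} [Fintype σ] {X : Set (σ → ℂ)} (hX : IsAlgSet X)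
    (m : ℕ) : (∃ c : Fin (m + 1) → Set (σ → ℂ), StrictMono c ∧ ∀ i, IsIrrAlg (c i) ∧ c i ⊆ X) ↔
      (m : WithBot ℕ∞) ≤ ringKrullDim (MvPolynomial σ ℂ ⧸ vanishingIdeal ℂ X) := by
  rw [ringKrullDim_quotient, Order.le_krullDim_iff]
  constructor
  · rintro ⟨c, hc, hcX⟩
    refine ⟨LTSeries.mk m (fun i => ⟨⟨vanishingIdeal ℂ (c i.rev),
      (hcX _).1.isPrime_vanishingIdeal⟩, vanishingIdeal_anti_mono (hcX _).2⟩)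
      fun i j hij => ?_, rfl⟩
    have hlt := hc (Fin.rev_lt_rev.mpr hij)
    refine lt_of_le_of_ne (vanishingIdeal_anti_mono hlt.le) fun h => hlt.ne ?_
    have h' : vanishingIdeal ℂ (c i.rev) = vanishingIdeal ℂ (c j.rev) :=
      congrArg (fun p => p.1.asIdeal) h
    rw [← (hcX i.rev).1.2.1.zeroLocus_vanishingIdeal, h',
      (hcX j.rev).1.2.1.zeroLocus_vanishingIdeal]
  · rintro ⟨l, rfl⟩
    refine ⟨fun i => zeroLocus ℂ (l i.rev).1.asIdeal, fun i j hij => ?_,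
      fun i => ⟨isIrrAlg_zeroLocus (hJ := (l i.rev).1.2) _, ?_⟩⟩
    · have hlt := l.strictMono (Fin.rev_lt_rev.mpr hij)
      refine lt_of_le_of_ne (zeroLocus_anti_mono hlt.le) fun h => hlt.ne ?_
      have := congrArg (vanishingIdeal ℂ) h
      rw [IsPrime.vanishingIdeal_zeroLocus (h := (l i.rev).1.2),
        IsPrime.vanishingIdeal_zeroLocus (h := (l j.rev).1.2)] at this
      exact Subtype.ext (PrimeSpectrum.ext this.symm)
    · conv_rhs => rw [← hX.zeroLocus_vanishingIdeal]
      exact zeroLocus_anti_mono (l i.rev).2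

open MvPolynomial in
lemma coe_adim_eq_ringKrullDim {σ : Type*} [Fintype σ] {X : Set (σ → ℂ)} (hX : IsIrrAlg X) :
    (adim X : WithBot ℕ∞) = ringKrullDim (MvPolynomial σ ℂ ⧸ vanishingIdeal ℂ X) := by
  have := hX.isPrime_vanishingIdeal
  have hbot : ringKrullDim (MvPolynomial σ ℂ ⧸ vanishingIdeal ℂ X) ≠ ⊥ :=
    Order.bot_lt_krullDim.ne'
  obtain ⟨e, he⟩ := WithBot.ne_bot_iff_exists.mp hbot
  have key := exists_chain_isIrrAlg_iff hX.2.1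
  rw [← he] at key ⊢
  congr 1
  simp only [adim, key]
  refine le_antisymm (sSup_le ?_) (ENat.forall_natCast_le_iff_le.mp fun m hm =>
    le_sSup ⟨m, rfl, by exact_mod_cast hm⟩)
  rintro _ ⟨m, rfl, hm⟩
  exact_mod_cast hm

lemma ringKrullDim_eq_of_isIntegral_of_faithfulSMul {S A : Type*} [CommRing S] [CommRing A]
    [Nontrivial A] [Algebra S A] [Algebra.IsIntegral S A] [FaithfulSMul S A] :
    ringKrullDim A = ringKrullDim S := by
  refine le_antisymm (Order.krullDim_le_of_strictMono (PrimeSpectrum.comap (algebraMap S A))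
    fun p q hpq => ?_) ?_
  · exact Ideal.IsIntegral.comap_lt_comap hpq
  · refine iSup_le fun l => ?_
    obtain ⟨P, hP, hPl⟩ := (Ideal.nonempty_primesOver (S := A) l.head.asIdeal).some
    obtain ⟨L, hL, -⟩ := Ideal.exists_ltSeries_of_hasGoingUp l P
    rw [← hL]
    exact Order.LTSeries.length_le_krullDim L


/-- A Noether normalization of the coordinate ring of `X` has `adim X` variables. -/
lemma exists_noetherNormalization_of_adim {σ : Type*} [Fintype σ] {X : Set (σ → ℂ)}
    (hX : IsIrrAlg X) {d : ℕ} (hd : adim X = d) :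
    ∃ g : MvPolynomial (Fin d) ℂ →ₐ[ℂ] MvPolynomial σ ℂ ⧸ MvPolynomial.vanishingIdeal ℂ X,
      Function.Injective g ∧ g.IsIntegral := by
  have := hX.isPrime_vanishingIdeal
  obtain ⟨s, g, hg, hgi⟩ := exists_integral_inj_algHom_of_fg ℂ
    (MvPolynomial σ ℂ ⧸ MvPolynomial.vanishingIdeal ℂ X)
  obtain rfl : s = d := by
    let : Algebra (MvPolynomial (Fin s) ℂ)
      (MvPolynomial σ ℂ ⧸ MvPolynomial.vanishingIdeal ℂ X) := g.toRingHom.toAlgebra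
    have : Algebra.IsIntegral (MvPolynomial (Fin s) ℂ)
      (MvPolynomial σ ℂ ⧸ MvPolynomial.vanishingIdeal ℂ X) := ⟨hgi⟩
    have : FaithfulSMul (MvPolynomial (Fin s) ℂ)
      (MvPolynomial σ ℂ ⧸ MvPolynomial.vanishingIdeal ℂ X) :=
      (faithfulSMul_iff_algebraMap_injective _ _).mpr hg
    have h := coe_adim_eq_ringKrullDim hX
    rw [ringKrullDim_eq_of_isIntegral_of_faithfulSMul (S := MvPolynomial (Fin s) ℂ), hd,
      MvPolynomial.ringKrullDim_of_isNoetherianRing, ringKrullDim_eq_zero_of_field] at h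
    simp at h
    exact_mod_cast h.symm
  exact ⟨g, hg, hgi⟩

open MvPolynomial in
/-- On a non-empty open subset, the tangent spaces have the dimension of the variety. -/
lemma exists_finrank_tangentAt_eq_of_adim {σ : Type*} [Fintype σ] {X : Set (σ → ℂ)}
    (hX : IsIrrAlg X) {d : ℕ} (hd : adim X = d) :
    ∃ D ∉ vanishingIdeal ℂ X, ∀ p ∈ X, aeval p D ≠ 0 →
      Module.finrank ℂ (tangentAt (vanishingIdeal ℂ X) (aeval p : _ →ₐ[ℂ] ℂ).toRingHom) = d := by
  have hprime := hX.isPrime_vanishingIdeal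
  set I := vanishingIdeal ℂ X
  obtain ⟨g, hg, hgi⟩ : ∃ g : MvPolynomial (Fin d) ℂ →ₐ[ℂ] MvPolynomial σ ℂ ⧸ I,
    Function.Injective g ∧ g.IsIntegral := exists_noetherNormalization_of_adim hX hd
  let K := FractionRing (MvPolynomial σ ℂ ⧸ I)
  have hΩ : Module.finrank K (Ω[K⁄ℂ]) = d := by
    let : Algebra (MvPolynomial (Fin d) ℂ) (MvPolynomial σ ℂ ⧸ I) := g.toRingHom.toAlgebra
    have : IsScalarTower ℂ (MvPolynomial (Fin d) ℂ) (MvPolynomial σ ℂ ⧸ I) :=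
      .of_algebraMap_eq fun x => (g.commutes x).symm
    have : Algebra.IsIntegral (MvPolynomial (Fin d) ℂ) (MvPolynomial σ ℂ ⧸ I) := ⟨hgi⟩
    have : FaithfulSMul (MvPolynomial (Fin d) ℂ) (MvPolynomial σ ℂ ⧸ I) :=
      (faithfulSMul_iff_algebraMap_injective _ _).mpr hg
    simpa using finrank_kaehlerDifferential_of_isIntegral (ι := Fin d) (k := ℂ)
      (A := MvPolynomial σ ℂ ⧸ I) (K := K)
  have hsurj : Function.Surjective (algebraMap (MvPolynomial σ ℂ) (MvPolynomial σ ℂ ⧸ I)) :=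
    Ideal.Quotient.mk_surjective
  have hker : RingHom.ker (algebraMap (MvPolynomial σ ℂ) (MvPolynomial σ ℂ ⧸ I)) = I :=
    Ideal.mk_ker
  obtain ⟨D, hD, hDp⟩ := exists_finrank_tangentAt_eq (A := MvPolynomial σ ℂ ⧸ I) K ℂ hsurj
  refine ⟨D, fun h => hD (Ideal.Quotient.eq_zero_iff_mem.mpr h), fun p hp hpD => ?_⟩
  have hgen := finrank_tangentAt_generic (A := MvPolynomial σ ℂ ⧸ I) (K := K) hsurj
  have := hDp (Ideal.Quotient.lift I (aeval p : MvPolynomial σ ℂ →ₐ[ℂ] ℂ).toRingHom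
    fun P hP => hP p hp) hpD
  rw [hgen, hΩ, hker] at this
  exact this

lemma coe_tangentAt_eq_tangSp {n : ℕ} (X : Set (Fin n → ℂ)) (p : Fin n → ℂ) :
    (tangentAt (MvPolynomial.vanishingIdeal ℂ X)
      (MvPolynomial.aeval p : _ →ₐ[ℂ] ℂ).toRingHom : Set (Fin n → ℂ)) = TangSp X p := by
  ext w
  have key (P : MvPolynomial (Fin n) ℂ) :
      fderiv ℂ (fun y : Fin n → ℂ => MvPolynomial.aeval y P) p w =
        ∑ i, MvPolynomial.aeval p (MvPolynomial.pderiv i P) * w i := by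
    rw [(hasFDerivAt_aeval P p).fderiv]
    simp
  constructor
  · intro hw f hf hfX
    obtain ⟨P, hP⟩ := mem_polyFun_iff.mp hf
    obtain rfl : f = fun x => MvPolynomial.aeval x P := funext hP
    rw [key]
    exact hw P hfX
  · intro hw P hP
    exact (key P).symm.trans (hw _ (mem_polyFun_iff.mpr ⟨P, fun _ => rfl⟩) hP)

/-- The restriction of a polynomial to the parametrized line `x + t v`. -/
def MvPolynomial.restrictLine {σ : Type*} (x v : σ → ℂ) : MvPolynomial σ ℂ →ₐ[ℂ] Polynomial ℂ :=
  aeval fun i => Polynomial.C (x i) + Polynomial.C (v i) * Polynomial.X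

lemma MvPolynomial.eval_restrictLine {σ : Type*} (x v : σ → ℂ) (t : ℂ) (P : MvPolynomial σ ℂ) :
    (restrictLine x v P).eval t = aeval (x + t • v) P := by
  have : (Polynomial.aeval t).comp (restrictLine x v) = aeval (x + t • v) := by
    ext i
    simp [restrictLine, mul_comm t]
  rw [← this, AlgHom.comp_apply, Polynomial.coe_aeval_eq_eval]

lemma MvPolynomial.derivative_restrictLine {σ : Type*} [Fintype σ] (x v : σ → ℂ)
    (P : MvPolynomial σ ℂ) :
    (restrictLine x v P).derivative = restrictLine x v (∑ i, v i • pderiv i P) := by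
  classical
  induction P using MvPolynomial.induction_on with
  | C a => simp [restrictLine]
  | add P Q hP hQ => simp [hP, hQ, Finset.sum_add_distrib]
  | mul_X P i hP =>
    have h : (restrictLine x v (X i)).derivative = Polynomial.C (v i) := by simp [restrictLine]
    have hsum : ∑ j, v j • pderiv j (P * X i) = (∑ j, v j • pderiv j P) * X i + v i • P := by
      simp [Derivation.leibniz, pderiv_X, Pi.single_apply, Finset.sum_add_distrib, Finset.sum_mul,
        mul_comm (X i), add_comm]
    rw [map_mul, Polynomial.derivative_mul, hP, h, hsum, map_add, map_mul, map_smul,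
      Polynomial.smul_eq_C_mul, mul_comm (Polynomial.C _)]

open MvPolynomial in
lemma IsCone.self_mem_tangentAt {σ : Type*} [Fintype σ] {X : Set (σ → ℂ)} (hX : IsCone X)
    {p : σ → ℂ} (hp : p ∈ X) :
    p ∈ tangentAt (vanishingIdeal ℂ X) (aeval p : _ →ₐ[ℂ] ℂ).toRingHom := by
  rw [mem_tangentAt]
  intro P hP
  have h0 : restrictLine 0 p P = 0 := Polynomial.funext fun t => by
    rw [eval_restrictLine, zero_add, hP _ (hX.2 t p hp), Polynomial.eval_zero]
  have h1 := eval_restrictLine 0 p 1 (∑ i, p i • pderiv i P)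
  rw [← derivative_restrictLine, h0, Polynomial.derivative_zero, Polynomial.eval_zero, one_smul,
    zero_add, map_sum] at h1
  rw [h1]
  exact Finset.sum_congr rfl fun i _ => by rw [map_smul, smul_eq_mul, mul_comm]; rfl

open MvPolynomial in
/-- A variety all of whose general tangent spaces contain `v` is stable under translation by `v`. -/
lemma add_smul_mem_of_forall_mem_tangentAt {σ : Type*} [Fintype σ] {X : Set (σ → ℂ)}
    (hX : IsAlgSet X) {v : σ → ℂ}
    (hv : ∀ P ∈ vanishingIdeal ℂ X, ∑ i, v i • pderiv i P ∈ vanishingIdeal ℂ X)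
    {x : σ → ℂ} (hx : x ∈ X) (t : ℂ) : x + t • v ∈ X := by
  have hconst (P) (hP : P ∈ vanishingIdeal ℂ X) (h : (restrictLine x v P).derivative = 0) :
      restrictLine x v P = 0 := by
    have h0 := eval_restrictLine x v 0 P
    rw [Polynomial.eq_C_of_natDegree_eq_zero (Polynomial.derivative_eq_zero.mp h)] at h0 ⊢
    rwa [zero_smul, add_zero, hP x hx, Polynomial.eval_C, ← Polynomial.C_eq_zero] at h0
  have hzero (m : ℕ) : ∀ P ∈ vanishingIdeal ℂ X, (restrictLine x v P).natDegree ≤ m →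
      restrictLine x v P = 0 := by
    induction m with
    | zero => exact fun P hP hm =>
        hconst P hP (Polynomial.derivative_eq_zero.mpr (Nat.le_zero.mp hm))
    | succ m ih =>
      refine fun P hP hm => hconst P hP ?_
      rw [derivative_restrictLine]
      refine ih _ (hv P hP) ?_
      rw [← derivative_restrictLine]
      exact (Polynomial.natDegree_derivative_le _).trans (by omega)
  rw [← hX.zeroLocus_vanishingIdeal]
  intro P hP
  rw [← eval_restrictLine, hzero _ P hP le_rfl, Polynomial.eval_zero]

lemma Submodule.isIrrAlg {σ : Type*} [Fintype σ] (L : Submodule ℂ (σ → ℂ)) :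
    IsIrrAlg (L : Set (σ → ℂ)) := by
  refine ⟨⟨0, L.zero_mem⟩, ?_, fun Y Z hY hZ hL => ?_⟩
  · refine ⟨{f | ∃ φ ∈ L.dualAnnihilator, f = fun x => φ x}, ?_, ?_⟩
    · rintro _ ⟨φ, -, rfl⟩
      exact Algebra.subset_adjoin φ.isLinear
    · ext x
      refine ⟨?_, fun h => ?_⟩
      · rintro hx _ ⟨φ, hφ, rfl⟩
        exact (mem_dualAnnihilator φ).mp hφ x hx
      · exact (Subspace.forall_mem_dualAnnihilator_apply_eq_zero_iff L x).mp
          fun φ hφ => h _ ⟨φ, hφ, rfl⟩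
  · by_contra! h
    obtain ⟨a, haL, haY⟩ := Set.not_subset.mp h.1
    obtain ⟨b, hbL, hbZ⟩ := Set.not_subset.mp h.2
    have key {Y : Set (σ → ℂ)} (hY : IsAlgSet Y) {a : σ → ℂ} (ha : a ∉ Y) :
        ∃ P : MvPolynomial σ ℂ, (∀ y ∈ Y, MvPolynomial.aeval y P = 0) ∧
          MvPolynomial.aeval a P ≠ 0 := by
      rw [← hY.zeroLocus_vanishingIdeal, MvPolynomial.mem_zeroLocus_iff] at ha
      push Not at ha
      exact ha
    obtain ⟨P, hPY, hPa⟩ := key hY haY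
    obtain ⟨Q, hQZ, hQb⟩ := key hZ hbZ
    have hPQ : MvPolynomial.restrictLine a (b - a) P *
        MvPolynomial.restrictLine a (b - a) Q = 0 := by
      refine Polynomial.funext fun s => ?_
      rw [Polynomial.eval_mul, MvPolynomial.eval_restrictLine,
        MvPolynomial.eval_restrictLine, Polynomial.eval_zero]
      rcases hL (L.add_mem haL (L.smul_mem s (L.sub_mem hbL haL))) with h | h
      · rw [hPY _ h, zero_mul]
      · rw [hQZ _ h, mul_zero]
    rcases mul_eq_zero.mp hPQ with h | h
    · refine hPa ?_
      have := MvPolynomial.eval_restrictLine a (b - a) 0 P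
      rwa [h, Polynomial.eval_zero, zero_smul, add_zero, eq_comm] at this
    · refine hQb ?_
      have := MvPolynomial.eval_restrictLine a (b - a) 1 Q
      rwa [h, Polynomial.eval_zero, one_smul, add_sub_cancel, eq_comm] at this

open MvPolynomial in
/-- A polynomial vanishing on a non-empty open subset of an irreducible set vanishes on it. -/
lemma IsIrrAlg.mem_vanishingIdeal_of_open {σ : Type*} [Fintype σ] {X : Set (σ → ℂ)}
    (hX : IsIrrAlg X) {D P : MvPolynomial σ ℂ} (hD : D ∉ vanishingIdeal ℂ X)
    (hP : ∀ x ∈ X, aeval x D ≠ 0 → aeval x P = 0) : P ∈ vanishingIdeal ℂ X := by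
  refine (hX.isPrime_vanishingIdeal.mem_or_mem (x := D) fun x hx => ?_).resolve_left hD
  rw [map_mul]
  by_cases h : aeval x D = 0
  · rw [h, zero_mul]
  · rw [hP x hx h, mul_zero]

open MvPolynomial in
/-- An irreducible set having a non-empty open subset in an algebraic set lies in the latter. -/
lemma IsIrrAlg.subset_of_open {σ : Type*} [Fintype σ] {X Y : Set (σ → ℂ)}
    (hX : IsIrrAlg X) (hY : IsAlgSet Y) {D : MvPolynomial σ ℂ} (hD : D ∉ vanishingIdeal ℂ X)
    (h : ∀ x ∈ X, aeval x D ≠ 0 → x ∈ Y) : X ⊆ Y := by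
  intro x hx
  rw [← hY.zeroLocus_vanishingIdeal]
  exact fun P hP => hX.mem_vanishingIdeal_of_open hD (fun y hy hyD => hP y (h y hy hyD)) x hx

/-- A cone of affine dimension two which is invariant under translations by a non-zero vector
spans at most a plane. -/
lemma finrank_span_le_two_of_add_smul_mem {σ : Type*} [Fintype σ] {X : Set (σ → ℂ)}
    (hXirr : IsIrrAlg X) (hX : IsCone X) (hdim : adim X = 2) {v : σ → ℂ} (hv0 : v ≠ 0)
    (hv : ∀ x ∈ X, ∀ t : ℂ, x + t • v ∈ X) : Module.finrank ℂ (span ℂ X) ≤ 2 := by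
  classical
  by_contra! hfin
  have hspan {x} (hx : x ∈ X) : (span ℂ {v, x} : Set (σ → ℂ)) ⊆ X := by
    intro y hy
    obtain ⟨a, b, rfl⟩ := mem_span_pair.mp hy
    rw [add_comm]
    exact hv _ (hX.2 b x hx) a
  have hXv : ¬ X ⊆ span ℂ {v} := fun h => by
    have h1 := Submodule.finrank_mono (span_le.mpr h)
    rw [finrank_span_singleton hv0] at h1
    omega
  obtain ⟨x, hx, hxv⟩ := Set.not_subset.mp hXv
  have hXvx : ¬ X ⊆ span ℂ {v, x} := fun h => by
    have h1 := Submodule.finrank_mono (span_le.mpr h)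
    have h2 : Module.finrank ℂ (span ℂ {v, x}) ≤ ({v, x} : Finset (σ → ℂ)).card := by
      rw [← Finset.coe_pair]
      exact finrank_span_finset_le_card _
    have h3 := Finset.card_le_two (a := v) (b := x)
    omega
  have hvx : span ℂ {v} ≤ span ℂ {v, x} := span_mono (by simp)
  let c : Fin 4 → Set (σ → ℂ) := ![(⊥ : Submodule ℂ (σ → ℂ)), span ℂ {v}, span ℂ {v, x}, X]
  have hc : StrictMono c := by
    rw [Fin.strictMono_iff_lt_succ]
    intro i
    fin_cases i
    · exact SetLike.coe_ssubset_coe.mpr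
        (bot_lt_iff_ne_bot.mpr (span_singleton_eq_bot.not.mpr hv0))
    · exact SetLike.coe_ssubset_coe.mpr (lt_of_le_of_ne hvx fun h =>
        hxv (h ▸ subset_span (by simp)))
    · exact ⟨hspan hx, hXvx⟩
  have hcX (i) : IsIrrAlg (c i) ∧ c i ⊆ X := by
    fin_cases i
    · exact ⟨Submodule.isIrrAlg _, by simpa [c] using hX.1⟩
    · exact ⟨Submodule.isIrrAlg _, (SetLike.coe_subset_coe.mpr hvx).trans (hspan hx)⟩
    · exact ⟨Submodule.isIrrAlg _, hspan hx⟩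
    · exact ⟨hXirr, subset_rfl⟩
  have h3 : ((3 : ℕ) : ℕ∞) ≤ adim X := le_sSup ⟨3, rfl, c, hc, hcX⟩
  rw [hdim] at h3
  exact absurd h3 (by decide)

/-- A non-degenerate irreducible curve in `P^r`, `r ≥ 3`, has two disjoint tangent
lines at smooth points (the tangent lines correspond to `2`-dimensional tangent spaces
of the affine cone, and disjointness of the projective lines means the tangent spaces
meet only at `0`). -/
theorem exists_disjoint_tangent_lines (r : ℕ) (hr : 3 ≤ r)
    (X : Set (Fin (r + 1) → ℂ)) (hX : IsProjVar X) (hnd : Nondeg X)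
    (hcurve : pdim X = 1) :
    ∃ p ∈ X, ∃ q ∈ X, ∃ Tp Tq : Submodule ℂ (Fin (r + 1) → ℂ),
      (Tp : Set (Fin (r + 1) → ℂ)) = TangSp X p ∧
      (Tq : Set (Fin (r + 1) → ℂ)) = TangSp X q ∧
      Module.finrank ℂ Tp = 2 ∧ Module.finrank ℂ Tq = 2 ∧ Tp ⊓ Tq = ⊥ := by
  obtain ⟨-, hcone, hirr, -⟩ := hX
  have hdim : adim X = 2 := by
    rw [pdim] at hcurve
    have h0 : 1 ≤ adim X := by
      by_contra! h
      rw [tsub_eq_zero_of_le h.le] at hcurve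
      exact zero_ne_one hcurve
    rw [← tsub_add_cancel_of_le h0, hcurve]
    norm_num
  have hspan : Module.finrank ℂ (span ℂ X) = r + 1 := by
    rw [hnd, finrank_top, Module.finrank_fin_fun]
  obtain ⟨D, hD, hfin⟩ := exists_finrank_tangentAt_eq_of_adim hirr (d := 2) hdim
  let T (p : Fin (r + 1) → ℂ) := tangentAt (MvPolynomial.vanishingIdeal ℂ X)
    (MvPolynomial.aeval p : MvPolynomial (Fin (r + 1)) ℂ →ₐ[ℂ] ℂ).toRingHom
  by_contra! hmeet
  have hne : ∃ p ∈ X, MvPolynomial.aeval p D ≠ 0 := by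
    by_contra! h
    exact hD h
  rcases Submodule.concurrent_or_coplanar (T '' {p | p ∈ X ∧ MvPolynomial.aeval p D ≠ 0})
    (Set.Nonempty.image T hne) (Set.forall_mem_image.mpr fun p hp => hfin p hp.1 hp.2)
    (Set.forall_mem_image.mpr fun p hp => Set.forall_mem_image.mpr fun q hq =>
      hmeet p hp.1 q hq.1 _ _ (coe_tangentAt_eq_tangSp X p) (coe_tangentAt_eq_tangSp X q)
        (hfin p hp.1 hp.2) (hfin q hq.1 hq.2)) with ⟨v, hv0, hv⟩ | ⟨L, hL, hTL⟩
  · have h2 := finrank_span_le_two_of_add_smul_mem hirr hcone hdim hv0 fun x hx t =>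
      add_smul_mem_of_forall_mem_tangentAt hirr.2.1 (fun P hP =>
        hirr.mem_vanishingIdeal_of_open hD fun p hp hpD => ?_) hx t
    · omega
    · rw [map_sum, ← mem_tangentAt.mp (hv _ ⟨p, ⟨hp, hpD⟩, rfl⟩) P hP]
      exact Finset.sum_congr rfl fun i _ => by rw [map_smul, smul_eq_mul, mul_comm]; rfl
  · have hXL : X ⊆ L := hirr.subset_of_open L.isIrrAlg.2.1 hD fun p hp hpD =>
      hTL _ ⟨p, ⟨hp, hpD⟩, rfl⟩ (hcone.self_mem_tangentAt hp)
    have := Submodule.finrank_mono (span_le.mpr hXL)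
    omega
end
end
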